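/- Let k be a field of characteristic zero with algebraic closure k̄, let a₁,…,aₙ be positive integers, and let X be an integral scheme of finite type over k whose base change X ×_{Spec k} Spec k̄ is isomorphic over k̄ to the fiber product ℙ^{a₁}_{k̄} ×_{k̄} ⋯ ×_{k̄} ℙ^{aₙ}_{k̄}. Let d₁ < d₂ < ⋯ < d_r be the distinct values among a₁,…,aₙ and let m_s be the number of indices i with aᵢ = d_s. Then there exist k-schemes Y₁,…,Y_r such that X is isomorphic over k to the fiber product Y₁ ×_k ⋯ ×_k Y_r, and for each s the base change Y_s ×_{Spec k} Spec k̄ is isomorphic over k̄ to the m_s-fold fiber product (ℙ^{d_s}_{k̄})^{m_s}. (In words: a k-form of a product of projective spaces is a product of k-forms of the products of the equal-dimensional factors, because the Galois group cannot permute the contractions onto factors of different dimensions.) -/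

import Mathlib

open AlgebraicGeometry CategoryTheory CategoryTheory.Limits MvPolynomial

attribute [local instance] MvPolynomial.gradedAlgebra

/-- Projective `m`-space over `K`, as `Proj` of the standard graded polynomial
ring `K[x₀, …, x_m]`. -/
noncomputable def ProjSpace (K : Type) [Field K] (m : ℕ) : Scheme :=
  Proj (homogeneousSubmodule (Fin (m + 1)) K)

/-- The structure morphism `ℙ^m_K ⟶ Spec K`. -/
noncomputable def ProjSpace.structMor (K : Type) [Field K] (m : ℕ) :
    ProjSpace K m ⟶ Spec (CommRingCat.of K) :=
  Proj.toSpecZero (homogeneousSubmodule (Fin (m + 1)) K) ≫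
    Spec.map (CommRingCat.ofHom
      (algebraMap K ↥(homogeneousSubmodule (Fin (m + 1)) K 0)))

/-- The iterated fiber product over a base scheme `B` of a list of schemes
over `B`, together with its structure morphism to `B`.  The empty product is
`B` itself. -/
noncomputable def fiberProdList (B : Scheme) :
    List ((Y : Scheme) × (Y ⟶ B)) → (P : Scheme) × (P ⟶ B)
  | [] => ⟨B, 𝟙 B⟩
  | (Y :: l) => ⟨pullback Y.2 (fiberProdList B l).2,
      pullback.fst Y.2 (fiberProdList B l).2 ≫ Y.2⟩

/-- Two coordinate vectors are proportional. -/
def Par {R : Type*} [Mul R] {N : Type*} (v w : N → R) : Prop := ∀ l m, v l * w m = v m * w l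

namespace Par

variable {R : Type*} [CommRing R] {N : Type*} {u v w : N → R}

lemma refl (v : N → R) : Par v v := fun _ _ => mul_comm _ _

lemma symm (h : Par v w) : Par w v := fun l m => by
  rw [mul_comm, h m l, mul_comm]

lemma trans [IsDomain R] (h : Par u v) (h' : Par v w) (hv : v ≠ 0) : Par u w := by
  obtain ⟨p, hp⟩ := Function.ne_iff.mp hv
  have hp : v p ≠ 0 := hp
  intro l m
  apply mul_left_cancel₀ hp
  linear_combination w m * h l p - w l * h m p + u p * h' l m

lemma smul_left (c : R) (v : N → R) : Par (c • v) v := fun l m => by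
  simp only [Pi.smul_apply, smul_eq_mul]; ring

lemma exists_smul {K : Type*} [Field K] {v w : N → K} (h : Par v w) (hv : v ≠ 0) (hw : w ≠ 0) :
    ∃ c : K, c ≠ 0 ∧ v = c • w := by
  obtain ⟨p, hp⟩ := Function.ne_iff.mp hv
  obtain ⟨q, hq⟩ := Function.ne_iff.mp hw
  have hp : v p ≠ 0 := hp
  have hq : w q ≠ 0 := hq
  have hvq : v q ≠ 0 := by
    intro h0
    have := h p q
    rw [h0, zero_mul] at this
    exact mul_ne_zero hp hq this
  refine ⟨v q / w q, div_ne_zero hvq hq, ?_⟩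
  ext l
  simp only [Pi.smul_apply, smul_eq_mul]
  field_simp
  rw [h l q]

end Par

lemma MvPolynomial.eq_of_eval_mul {σ K : Type*} [Field K] [Infinite K] {p q g : MvPolynomial σ K}
    (hg : g ≠ 0) (h : ∀ x, eval x g ≠ 0 → eval x p = eval x q) : p = q := by
  have : g * (p - q) = 0 := by
    apply MvPolynomial.funext
    intro x
    by_cases hx : eval x g = 0
    · simp [hx]
    · simp [h x hx]
  rcases mul_eq_zero.mp this with h | h
  · exact absurd h hg
  · exact sub_eq_zero.mp h

/-- A map from a set of points to projective space which is locally given by polynomials is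
globally given by a coprime tuple of polynomials. -/
lemma MvPolynomial.exists_coprime_representation {σ K : Type*} [Field K] [Infinite K]
    {N : Type*} [Fintype N]
    (T : Set (σ → K)) (t : MvPolynomial σ K) (ht : t ≠ 0) (htT : ∀ x, eval x t ≠ 0 → x ∈ T)
    (hT : T.Nonempty) (φ : (σ → K) → N → K) (hφ : ∀ x ∈ T, φ x ≠ 0)
    (hloc : ∀ x ∈ T, ∃ (H : N → MvPolynomial σ K) (f : MvPolynomial σ K), eval x f ≠ 0 ∧
      ∀ y ∈ T, eval y f ≠ 0 → (fun l => eval y (H l)) ≠ 0 ∧ Par (fun l => eval y (H l)) (φ y)) :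
    ∃ G : N → MvPolynomial σ K, (∀ u p, (∀ l, p ∣ u * G l) → p ∣ u) ∧
      ∀ x ∈ T, (fun l => eval x (G l)) ≠ 0 ∧ Par (fun l => eval x (G l)) (φ x) := by
  classical
  obtain ⟨x₀, hx₀⟩ := hT
  obtain ⟨H₀, f₀, hf₀, hH₀⟩ := hloc x₀ hx₀
  have hne : Nonempty N := by
    obtain ⟨l, -⟩ := Function.ne_iff.mp (hφ x₀ hx₀)
    exact ⟨l⟩
  let _ : NormalizationMonoid (MvPolynomial σ K) := Classical.choice inferInstance
  let _ : NormalizedGCDMonoid (MvPolynomial σ K) :=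
    UniqueFactorizationMonoid.toNormalizedGCDMonoid _
  obtain ⟨G, hG, hG1⟩ := Finset.extract_gcd H₀ (Finset.univ_nonempty (α := N))
  set D := Finset.univ.gcd H₀ with hD
  have hD0 : D ≠ 0 := by
    intro h0
    apply (hH₀ x₀ hx₀ hf₀).1
    ext l
    simp [hG l (Finset.mem_univ l), h0]
  have hf₀0 : f₀ ≠ 0 := by rintro rfl; simp at hf₀
  have hcop : ∀ u p, (∀ l, p ∣ u * G l) → p ∣ u := by
    intro u p h
    have := Finset.dvd_gcd (s := Finset.univ) (f := fun l => u * G l) (fun l _ => h l)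
    have h2 := (Finset.gcd_mul_left' Finset.univ G u).dvd
    rw [hG1, mul_one] at h2
    exact this.trans h2
  refine ⟨G, hcop, fun x hx => ?_⟩
  obtain ⟨H, f, hf, hH⟩ := hloc x hx
  have hf0 : f ≠ 0 := by rintro rfl; simp at hf
  have key : ∀ l m, G l * H m = G m * H l := by
    intro l m
    apply eq_of_eval_mul (g := t * f * f₀ * D) (by simp [ht, hf0, hf₀0, hD0])
    intro y hy
    simp only [map_mul, mul_ne_zero_iff] at hy
    have hyT := htT y hy.1.1.1
    obtain ⟨-, h1⟩ := hH y hyT hy.1.1.2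
    obtain ⟨-, h2⟩ := hH₀ y hyT hy.1.2
    have h3 := h2.trans h1.symm (hφ y hyT) l m
    rw [hG l (Finset.mem_univ l), hG m (Finset.mem_univ m)] at h3
    simp only [map_mul] at h3 ⊢
    apply mul_left_cancel₀ hy.2
    linear_combination h3
  obtain ⟨m, hm⟩ := Function.ne_iff.mp (hH x hx hf).1
  have hm : eval x (H m) ≠ 0 := hm
  obtain ⟨u, hu⟩ : G m ∣ H m := hcop _ _ fun l => ⟨H l, by rw [← key l m, mul_comm]⟩
  have hGm : eval x (G m) ≠ 0 := by
    intro h0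
    rw [hu, map_mul, h0, zero_mul] at hm
    exact hm rfl
  have hne : (fun l => eval x (G l)) ≠ 0 := fun h0 => hGm (congrFun h0 m)
  refine ⟨hne, ?_⟩
  refine Par.trans (v := fun l => eval x (H l)) (fun l m => ?_) (hH x hx hf).2 (hH x hx hf).1
  simp only [← map_mul, key]

namespace MvPolynomial

variable {σ K : Type*} [Field K]

/-- The substitution `x_v ↦ 2 ^ w v * x_v`. -/
noncomputable def scaleTwo (w : σ → ℕ) : MvPolynomial σ K →ₐ[K] MvPolynomial σ K :=
  bind₁ fun v => C (2 ^ w v) * X v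

lemma eval_bind_one {τ : Type*} (x : τ → K) (f : σ → MvPolynomial τ K) (p : MvPolynomial σ K) :
    eval x (bind₁ f p) = eval (fun v => eval x (f v)) p :=
  eval₂Hom_bind₁ (RingHom.id K) x f p

lemma eval_scaleTwo (w : σ → ℕ) (x : σ → K) (p : MvPolynomial σ K) :
    eval x (scaleTwo w p) = eval (fun v => 2 ^ w v * x v) p := by
  simp [scaleTwo, eval_bind_one]

lemma scaleTwo_monomial (w : σ → ℕ) (α : σ →₀ ℕ) (b : K) :
    scaleTwo w (monomial α b) = monomial α (2 ^ Finsupp.weight w α * b) := by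
  rw [scaleTwo, bind₁_monomial, monomial_eq (a := 2 ^ Finsupp.weight w α * b), Finsupp.prod]
  simp only [mul_pow, Finset.prod_mul_distrib, map_mul]
  rw [Finsupp.weight_apply, Finsupp.sum, ← Finset.prod_pow_eq_pow_sum, map_prod]
  simp only [smul_eq_mul, map_pow, ← pow_mul, mul_comm]
  ring

lemma coeff_scaleTwo (w : σ → ℕ) (α : σ →₀ ℕ) (p : MvPolynomial σ K) :
    coeff α (scaleTwo w p) = 2 ^ Finsupp.weight w α * coeff α p := by
  classical
  induction p using MvPolynomial.induction_on' with
  | monomial β b =>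
    rw [scaleTwo_monomial, coeff_monomial, coeff_monomial]
    split_ifs with h
    · rw [h]
    · simp
  | add p q hp hq => simp [hp, hq, mul_add]

variable [CharZero K]

lemma support_scaleTwo (w : σ → ℕ) (p : MvPolynomial σ K) :
    (scaleTwo w p).support = p.support := by
  ext α
  simp [mem_support_iff, coeff_scaleTwo]

/-- If a coprime tuple is invariant up to proportionality under the substitution
`x_v ↦ 2 ^ w v * x_v`, then all its entries are weighted homogeneous of the same degree. -/
lemma exists_scaleTwo_eq {N : Type*} (w : σ → ℕ) (G : N → MvPolynomial σ K)
    (hG : ∀ u p, (∀ l, p ∣ u * G l) → p ∣ u) (hG0 : G ≠ 0)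
    (h : Par (fun l => scaleTwo w (G l)) G) :
    ∃ E : ℕ, ∀ l, scaleTwo w (G l) = C (2 ^ E) * G l := by
  obtain ⟨m, hm⟩ := Function.ne_iff.mp hG0
  have hm : G m ≠ 0 := hm
  obtain ⟨u, hu⟩ : G m ∣ scaleTwo w (G m) := hG _ _ fun l => ⟨scaleTwo w (G l), by
    rw [h m l, mul_comm]⟩
  have hdeg : (scaleTwo w (G m)).totalDegree = (G m).totalDegree := by
    simp only [totalDegree, support_scaleTwo]
  have hu0 : u ≠ 0 := by
    rintro rfl
    rw [mul_zero] at hu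
    have := support_scaleTwo w (G m)
    rw [hu] at this
    exact hm (support_eq_empty.mp this.symm)
  rw [hu, totalDegree_mul_of_isDomain hm hu0] at hdeg
  obtain ⟨c, rfl⟩ : ∃ c, u = C c := ⟨_, totalDegree_eq_zero_iff_eq_C.mp (by omega)⟩
  obtain ⟨α, hα⟩ := ne_zero_iff.mp hm
  have hc : c = 2 ^ Finsupp.weight w α := by
    have := congrArg (coeff α) hu
    rw [coeff_scaleTwo, mul_comm (G m), coeff_C_mul] at this
    exact (mul_right_cancel₀ hα this).symm
  refine ⟨Finsupp.weight w α, fun l => ?_⟩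
  rw [← hc]
  apply mul_right_cancel₀ hm
  have hlm : scaleTwo w (G l) * G m = scaleTwo w (G m) * G l := h l m
  rw [hlm, hu]
  ring

lemma weight_eq_of_scaleTwo_eq {w : σ → ℕ} {p : MvPolynomial σ K} {E : ℕ}
    (h : scaleTwo w p = C (2 ^ E) * p) {α : σ →₀ ℕ} (hα : coeff α p ≠ 0) :
    Finsupp.weight w α = E := by
  have := congrArg (coeff α) h
  rw [coeff_scaleTwo, coeff_C_mul] at this
  have := mul_right_cancel₀ hα this
  have h2 : ((2 ^ Finsupp.weight w α : ℕ) : K) = ((2 ^ E : ℕ) : K) := by exact_mod_cast this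
  exact Nat.pow_right_injective le_rfl (Nat.cast_injective h2)

end MvPolynomial

/-- A point with homogeneous coordinates in a product of projective spaces. -/
abbrev MultiPt (K : Type*) {ι : Type*} (a : ι → ℕ) := ∀ i, Fin (a i + 1) → K

/-- The Cox ring of a product of projective spaces. -/
abbrev CoxRing (K : Type*) [CommSemiring K] {ι : Type*} (a : ι → ℕ) :=
  MvPolynomial (Σ i, Fin (a i + 1)) K

/-- All the homogeneous coordinate vectors are nonzero. -/
def MultiPt.Good {K : Type*} [Zero K] {ι : Type*} {a : ι → ℕ} (x : MultiPt K a) : Prop :=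
  ∀ i, x i ≠ 0

/-- Evaluation of multihomogeneous polynomials. -/
noncomputable def MultiPt.ev {K : Type*} [CommSemiring K] {ι : Type*} {a : ι → ℕ}
    (x : MultiPt K a) : CoxRing K a →+* K := eval fun s => x s.1 s.2

/-- A map between sets of homogeneous coordinates which induces an algebraic map of products of
projective spaces. -/
structure IsRegularOnCoords {K : Type*} [Field K] {ι : Type*} {a : ι → ℕ}
    (Φ : MultiPt K a → MultiPt K a) : Prop where
  good : ∀ x : MultiPt K a, x.Good → (Φ x).Good
  par : ∀ x y : MultiPt K a, x.Good → y.Good → (∀ i, Par (x i) (y i)) → ∀ j, Par (Φ x j) (Φ y j)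
  loc : ∀ x : MultiPt K a, x.Good → ∀ j, ∃ (H : Fin (a j + 1) → CoxRing K a) (f : CoxRing K a),
    x.ev f ≠ 0 ∧ ∀ y : MultiPt K a, y.Good → y.ev f ≠ 0 →
      (fun l => y.ev (H l)) ≠ 0 ∧ Par (fun l => y.ev (H l)) (Φ y j)

section

variable {K : Type*} [Field K] {ι : Type*} {a : ι → ℕ} {Φ Ψ : MultiPt K a → MultiPt K a}

lemma MultiPt.ev_curry (x : (Σ i, Fin (a i + 1)) → K) :
    MultiPt.ev (a := a) (fun i l => x ⟨i, l⟩) = eval x := rfl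

lemma IsRegularOnCoords.exists_coprime [Infinite K] [Fintype ι] (hΦ : IsRegularOnCoords Φ) (j : ι) :
    ∃ G : Fin (a j + 1) → CoxRing K a, (∀ u p, (∀ l, p ∣ u * G l) → p ∣ u) ∧
      ∀ x : MultiPt K a, x.Good → (fun l => x.ev (G l)) ≠ 0 ∧
        Par (fun l => x.ev (G l)) (Φ x j) := by
  obtain ⟨G, hG, hG'⟩ := exists_coprime_representation (N := Fin (a j + 1))
    {x : (Σ i, Fin (a i + 1)) → K | MultiPt.Good (fun i l => x ⟨i, l⟩)}
    (∏ i, X ⟨i, 0⟩) (Finset.prod_ne_zero_iff.mpr fun i _ => X_ne_zero _)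
    (fun x hx i h => by
      rw [map_prod, Finset.prod_ne_zero_iff] at hx
      apply hx i (Finset.mem_univ i)
      rw [eval_X]
      exact congrFun h 0)
    ⟨fun _ => 1, fun i h => one_ne_zero (congrFun h 0)⟩
    (fun x => Φ (fun i l => x ⟨i, l⟩) j) (fun x hx => hΦ.good _ hx j)
    (fun x hx => by
      obtain ⟨H, f, hf, hH⟩ := hΦ.loc (fun i l => x ⟨i, l⟩) hx j
      rw [MultiPt.ev_curry] at hf
      refine ⟨H, f, hf, fun y hy hyf => ?_⟩
      have := hH (fun i l => y ⟨i, l⟩) hy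
      rw [MultiPt.ev_curry] at this
      exact this hyf)
  exact ⟨G, hG, fun x hx => hG' (fun s => x s.1 s.2) hx⟩

end

section

variable {K : Type*} [Field K] {ι : Type*} {a : ι → ℕ} {Φ Ψ : MultiPt K a → MultiPt K a}

lemma CoxRing.eq_of_ev [Infinite K] [Fintype ι] {p q : CoxRing K a}
    (h : ∀ x : MultiPt K a, x.Good → x.ev p = x.ev q) : p = q := by
  refine eq_of_eval_mul (g := ∏ i, X ⟨i, 0⟩)
    (Finset.prod_ne_zero_iff.mpr fun i _ => X_ne_zero _) fun x hx => ?_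
  refine h (fun i l => x ⟨i, l⟩) fun i hi => ?_
  rw [map_prod, Finset.prod_ne_zero_iff] at hx
  apply hx i (Finset.mem_univ i)
  rw [eval_X]
  exact congrFun hi 0

/-- The grading weight of a block of variables. -/
def blockWeight [DecidableEq ι] (a : ι → ℕ) (h : ι) : (Σ i, Fin (a i + 1)) → ℕ :=
  fun s => if s.1 = h then 1 else 0

lemma MultiPt.ev_scaleTwo (c : ι → ℕ) (x : MultiPt K a) (p : CoxRing K a) :
    x.ev (scaleTwo (fun s => c s.1) p) =
      MultiPt.ev (a := a) (fun i => (2 : K) ^ c i • x i) p := by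
  simp [MultiPt.ev, eval_scaleTwo]

lemma MultiPt.Good.scale [CharZero K] {x : MultiPt K a} (hx : x.Good) (c : ι → ℕ) :
    MultiPt.Good (a := a) (fun i => (2 : K) ^ c i • x i) :=
  fun i => smul_ne_zero (pow_ne_zero _ two_ne_zero) (hx i)

lemma scaleTwo_of_blocks [CharZero K] [Fintype ι] [DecidableEq ι] (c e : ι → ℕ) {p : CoxRing K a}
    (h : ∀ j, scaleTwo (blockWeight a j) p = C (2 ^ e j) * p) :
    scaleTwo (fun s => c s.1) p = C (2 ^ ∑ j, e j * c j) * p := by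
  ext α
  rw [coeff_scaleTwo, coeff_C_mul]
  by_cases hα : coeff α p = 0
  · simp [hα]
  congr 2
  simp_rw [← weight_eq_of_scaleTwo_eq (h _) hα, Finsupp.weight_apply, Finsupp.sum,
    Finset.sum_mul]
  rw [Finset.sum_comm]
  refine Finset.sum_congr rfl fun s _ => ?_
  simp [blockWeight]

lemma IsRegularOnCoords.exists_multidegree [CharZero K] [Fintype ι] [DecidableEq ι]
    (hΦ : IsRegularOnCoords Φ) {j : ι} {G : Fin (a j + 1) → CoxRing K a}
    (hG : ∀ u p, (∀ l, p ∣ u * G l) → p ∣ u)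
    (hG' : ∀ x : MultiPt K a, x.Good → (fun l => x.ev (G l)) ≠ 0 ∧
        Par (fun l => x.ev (G l)) (Φ x j)) (h : ι) :
    ∃ E : ℕ, ∀ l, scaleTwo (blockWeight a h) (G l) = C (2 ^ E) * G l := by
  refine exists_scaleTwo_eq _ G hG ?_ fun l m => CoxRing.eq_of_ev fun x hx => ?_
  · rintro rfl
    refine (hG' (fun _ _ => 1) fun i h => one_ne_zero (congrFun h 0)).1 ?_
    ext; simp
  · have hy := hx.scale (fun i => if i = h then 1 else 0)
    simp only [map_mul]
    unfold blockWeight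
    rw [MultiPt.ev_scaleTwo (fun i => if i = h then 1 else 0),
      MultiPt.ev_scaleTwo (fun i => if i = h then 1 else 0)]
    refine (((hG' _ hy).2.trans (hΦ.par _ _ hy hx (fun i => Par.smul_left _ _) j)
      (hΦ.good _ hy _)).trans (hG' _ hx).2.symm (hΦ.good _ hx _)) l m

/-- A polynomial without zeros among the good points is constant. -/
lemma CoxRing.exists_eq_C [IsAlgClosed K] [Finite ι] (ha : ∀ i, 1 ≤ a i) {u : CoxRing K a}
    (hu : ∀ x : MultiPt K a, x.Good → x.ev u ≠ 0) : ∃ c, c ≠ 0 ∧ u = C c := by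
  have := Fintype.ofFinite ι
  let t (l : ∀ i, Fin (a i + 1)) : CoxRing K a := ∏ i, X ⟨i, l i⟩
  have key : ∀ l, ∃ n, u ∣ (t l) ^ n := by
    intro l
    have : t l ∈ (Ideal.span {u}).radical := by
      rw [← vanishingIdeal_zeroLocus_eq_radical (K := K), mem_vanishingIdeal_iff]
      intro x hx
      by_contra hne
      have hg : MultiPt.Good (a := a) fun i m => x ⟨i, m⟩ := fun i hi => by
        apply hne
        simp only [t, map_prod, aeval_X]
        exact Finset.prod_eq_zero (Finset.mem_univ i) (congrFun hi _)
      apply hu _ hg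
      have := hx u (Ideal.mem_span_singleton_self u)
      rwa [aeval_eq_eval] at this
    obtain ⟨n, hn⟩ := this
    exact ⟨n, Ideal.mem_span_singleton.mp hn⟩
  obtain ⟨n, hn⟩ := key fun i => 0
  obtain ⟨n', hn'⟩ := key fun i => Fin.last _
  have hrel : IsRelPrime (t fun i => 0) (t fun i => Fin.last _) := by
    refine IsRelPrime.prod_left fun i _ => IsRelPrime.prod_right fun j _ => ?_
    rw [(X_prime (R := K)).irreducible.isRelPrime_iff_not_dvd, X_dvd_X]
    intro h
    have h1 := ha i
    obtain ⟨rfl, h2⟩ := Sigma.mk.inj_iff.mp h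
    have h3 := congrArg Fin.val (eq_of_heq h2)
    rw [Fin.val_zero, Fin.val_last] at h3
    omega
  have hunit : IsUnit u := hrel.pow hn hn'
  obtain ⟨c, hc, rfl⟩ := MvPolynomial.isUnit_iff_eq_C_of_isReduced.mp hunit
  exact ⟨c, hc.ne_zero, rfl⟩

lemma exists_eq_C_mul_X [IsAlgClosed K] [Finite ι] (ha : ∀ i, 1 ≤ a i) (i : ι)
    (R : Fin (a i + 1) → CoxRing K a)
    (hR : ∀ x : MultiPt K a, x.Good → (fun l => x.ev (R l)) ≠ 0 ∧
        Par (fun l => x.ev (R l)) (x i)) :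
    ∃ c : K, c ≠ 0 ∧ ∀ l, R l = C c * X ⟨i, l⟩ := by
  have := Fintype.ofFinite ι
  have := IsAlgClosed.instInfinite (K := K)
  have hev (x : MultiPt K a) (l) : x.ev (X ⟨i, l⟩) = x i l := by simp [MultiPt.ev]
  have hpar : ∀ l m, R l * X ⟨i, m⟩ = R m * X ⟨i, l⟩ := fun l m =>
    CoxRing.eq_of_ev fun x hx => by simpa only [map_mul, hev] using (hR x hx).2 l m
  have h0l : (0 : Fin (a i + 1)) ≠ Fin.last _ := by
    have := ha i
    rw [Ne, Fin.ext_iff, Fin.val_zero, Fin.val_last]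
    omega
  obtain ⟨u, hu⟩ : (X ⟨i, 0⟩ : CoxRing K a) ∣ R 0 := by
    refine ((X_prime (R := K)).dvd_or_dvd (b := X ⟨i, Fin.last _⟩)
      ⟨R (Fin.last _), ?_⟩).resolve_right ?_
    · rw [hpar, mul_comm]
    · rw [X_dvd_X]
      simpa using h0l
  have hul : ∀ l, R l = u * X ⟨i, l⟩ := fun l => by
    apply mul_right_cancel₀ (X_ne_zero (⟨i, 0⟩ : Σ i, Fin (a i + 1)))
    rw [hpar, hu]
    ring
  obtain ⟨c, hc, rfl⟩ := CoxRing.exists_eq_C ha (u := u) fun x hx h => (hR x hx).1 <| by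
    ext l
    simp [hul, h]
  exact ⟨c, hc, hul⟩

end

/-- Mutually inverse matrices of natural numbers are permutation matrices. -/
lemma Matrix.exists_perm_of_nat_mul_eq_one {ι : Type*} [Fintype ι] [DecidableEq ι]
    (A B : ι → ι → ℕ) (hBA : ∀ i h, ∑ j, B i j * A j h = if i = h then 1 else 0)
    (hAB : ∀ i h, ∑ j, A i j * B j h = if i = h then 1 else 0) (j : ι) :
    ∃ t, (∀ h, A j h = if t = h then 1 else 0) ∧ (∀ h, B t h = if j = h then 1 else 0) := by
  have h1 := hAB j j
  rw [if_pos rfl] at h1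
  obtain ⟨t, -, ht⟩ := Finset.exists_ne_zero_of_sum_ne_zero (h1.trans_ne one_ne_zero)
  have hle : A j t * B t j ≤ 1 := by
    rw [← h1]
    exact Finset.single_le_sum (f := fun h => A j h * B h j) (fun _ _ => Nat.zero_le _)
      (Finset.mem_univ t)
  have hmul : A j t * B t j = 1 := by omega
  have hA := Nat.eq_one_of_mul_eq_one_right hmul
  have hB := Nat.eq_one_of_mul_eq_one_left hmul
  refine ⟨t, fun h => ?_, fun h => ?_⟩
  · split_ifs with e
    · rw [← e, hA]
    · have := hBA t h
      rw [if_neg e, Finset.sum_eq_zero_iff] at this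
      simpa [hB] using this j (Finset.mem_univ j)
  · split_ifs with e
    · rw [← e, hB]
    · have := hAB j h
      rw [if_neg e, Finset.sum_eq_zero_iff] at this
      simpa [hA] using this t (Finset.mem_univ t)

section

variable {K : Type*} [Field K] {ι : Type*} {a : ι → ℕ} {Φ Ψ : MultiPt K a → MultiPt K a}

lemma MultiPt.ev_bind (x : MultiPt K a) (G : ∀ j, Fin (a j + 1) → CoxRing K a) (p : CoxRing K a) :
    x.ev (bind₁ (fun s => G s.1 s.2) p) = MultiPt.ev (a := a) (fun j l => x.ev (G j l)) p :=
  eval_bind_one _ _ _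

/-- Compatibility of multidegrees under substitution, when the composite is the identity up to
scalars. -/
lemma multidegree_mul_eq_one [CharZero K] [IsAlgClosed K] [Fintype ι] [DecidableEq ι]
    (ha : ∀ i, 1 ≤ a i)
    (hΦ : IsRegularOnCoords Φ) (hΨ : IsRegularOnCoords Ψ)
    (hΨΦ : ∀ x : MultiPt K a, x.Good → ∀ i, Par (Ψ (Φ x) i) (x i))
    (G F : ∀ j, Fin (a j + 1) → CoxRing K a)
    (hG : ∀ j, ∀ x : MultiPt K a, x.Good → (fun l => x.ev (G j l)) ≠ 0 ∧
        Par (fun l => x.ev (G j l)) (Φ x j))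
    (hF : ∀ j, ∀ x : MultiPt K a, x.Good → (fun l => x.ev (F j l)) ≠ 0 ∧
        Par (fun l => x.ev (F j l)) (Ψ x j))
    (E E' : ι → ι → ℕ) (hE : ∀ j h l, scaleTwo (blockWeight a h) (G j l) = C (2 ^ E j h) * G j l)
    (hE' : ∀ j h l, scaleTwo (blockWeight a h) (F j l) = C (2 ^ E' j h) * F j l) (i h : ι) :
    ∑ j, E' i j * E j h = if i = h then 1 else 0 := by
  have hGg (x : MultiPt K a) (hx : x.Good) :
      MultiPt.Good (a := a) (fun j l => x.ev (G j l)) := fun j => (hG j x hx).1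
  obtain ⟨c, hc, hR⟩ := exists_eq_C_mul_X ha i
    (fun m => bind₁ (fun s : Σ i, Fin (a i + 1) => G s.1 s.2) (F i m)) (by
      intro x hx
      simp only [MultiPt.ev_bind]
      refine ⟨(hF i _ (hGg x hx)).1, ?_⟩
      exact ((hF i _ (hGg x hx)).2.trans (hΨ.par _ _ (hGg x hx) (hΦ.good x hx)
        (fun j => (hG j x hx).2) i) (hΨ.good _ (hGg x hx) i)).trans (hΨΦ x hx i)
        (hΨ.good _ (hΦ.good x hx) i))
  have hR0 := hR 0
  let x : MultiPt K a := fun _ _ => 1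
  have h1 := congrArg x.ev hR0
  have h2 := congrArg (MultiPt.ev (a := a)
    (fun i => (2 : K) ^ (if i = h then 1 else 0) • x i)) hR0
  have hy : ∀ j l, MultiPt.ev (a := a) (fun i => (2 : K) ^ (if i = h then 1 else 0) • x i) (G j l) =
      2 ^ E j h * x.ev (G j l) := by
    intro j l
    rw [← MultiPt.ev_scaleTwo (fun i => if i = h then 1 else 0)]
    have := hE j h l
    unfold blockWeight at this
    rw [this, map_mul]
    simp [MultiPt.ev]
  rw [MultiPt.ev_bind] at h1 h2
  simp only [hy] at h2
  have h3 := MultiPt.ev_scaleTwo (fun j => E j h) (fun j l => x.ev (G j l)) (F i 0)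
  rw [scaleTwo_of_blocks (fun j => E j h) (E' i) (fun j => hE' i j 0), map_mul] at h3
  have h4 : (2 : K) ^ (∑ j, E' i j * E j h) * c = 2 ^ (if i = h then 1 else 0) * c := by
    have e1 : MultiPt.ev (a := a) (fun j l => x.ev (G j l)) (F i 0) = c := by
      rw [h1]; simp [MultiPt.ev, x]
    rw [e1] at h3
    have e2 : MultiPt.ev (a := a) (fun j l => x.ev (G j l)) (C (2 ^ ∑ j, E' i j * E j h)) =
      2 ^ ∑ j, E' i j * E j h := by simp [MultiPt.ev]
    rw [e2] at h3
    rw [h3]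
    refine h2.trans ?_
    simp [MultiPt.ev, x, mul_comm]
  have h5 := mul_right_cancel₀ hc h4
  have h6 : ((2 ^ ∑ j, E' i j * E j h : ℕ) : K) = ((2 ^ (if i = h then 1 else 0) : ℕ) : K) := by
    exact_mod_cast h5
  exact Nat.pow_right_injective le_rfl (Nat.cast_injective h6)

/-- A tuple of polynomials of multidegree `δ_t` is a tuple of linear forms in the `t`-th block. -/
lemma exists_linearMap_of_multidegree [CharZero K] [Fintype ι] [DecidableEq ι] {N : ℕ}
    (G : Fin N → CoxRing K a) (t : ι)
    (hE : ∀ h l, scaleTwo (blockWeight a h) (G l) = C (2 ^ (if t = h then 1 else 0)) * G l) :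
    ∃ L : (Fin (a t + 1) → K) →ₗ[K] (Fin N → K), ∀ x : MultiPt K a,
      (fun l => x.ev (G l)) = L (x t) := by
  have hsupp : ∀ l, ∀ α ∈ (G l).support, ∃ m, α = Finsupp.single ⟨t, m⟩ 1 := by
    intro l α hα
    have hw := fun h => weight_eq_of_scaleTwo_eq (hE h l) (mem_support_iff.mp hα)
    simp only [Finsupp.weight_apply, Finsupp.sum, blockWeight, smul_eq_mul, mul_ite, mul_one,
      mul_zero] at hw
    have hz : ∀ s ∈ α.support, s.1 = t := by
      intro s hs
      by_contra hne
      have := hw s.1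
      rw [if_neg (Ne.symm hne), Finset.sum_eq_zero_iff] at this
      have := this s hs
      rw [if_pos rfl] at this
      exact Finsupp.mem_support_iff.mp hs this
    have hdeg : α.degree = 1 := by
      have := hw t
      rw [if_pos rfl] at this
      refine Eq.trans ?_ this
      exact Finset.sum_congr rfl fun s hs => by rw [if_pos (hz s hs)]
    obtain ⟨s, rfl⟩ := (Finsupp.sum_eq_one_iff α).mp hdeg
    obtain rfl := hz s (by simp)
    exact ⟨s.2, rfl⟩
  refine ⟨∑ m, LinearMap.pi fun l => coeff (Finsupp.single ⟨t, m⟩ 1) (G l) • LinearMap.proj m,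
    fun x => ?_⟩
  ext l
  have : G l = ∑ m, monomial (Finsupp.single ⟨t, m⟩ 1) (coeff (Finsupp.single ⟨t, m⟩ 1) (G l)) := by
    ext α
    simp only [coeff_sum, coeff_monomial]
    by_cases hα : ∃ m, α = Finsupp.single ⟨t, m⟩ 1
    · obtain ⟨m, rfl⟩ := hα
      rw [Finset.sum_eq_single m]
      · simp
      · intro m' _ hne
        rw [if_neg]
        intro h
        apply hne
        have := Finsupp.single_left_injective (one_ne_zero) h
        simpa using this
      · simp
    · rw [Finset.sum_eq_zero]
      · by_contra hne
        exact hα (hsupp l α (mem_support_iff.mpr hne))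
      · intro m _
        rw [if_neg fun h => hα ⟨m, h.symm⟩]
  conv_lhs => rw [this]
  simp [MultiPt.ev, eval_monomial]

/-- An automorphism of a product of projective spaces respects the projection to the product of
the factors of a fixed dimension. -/
theorem IsRegularOnCoords.par_of_dim_eq [CharZero K] [IsAlgClosed K] [Fintype ι]
    (ha : ∀ i, 1 ≤ a i)
    (hΦ : IsRegularOnCoords Φ) (hΨ : IsRegularOnCoords Ψ)
    (hΨΦ : ∀ x : MultiPt K a, x.Good → ∀ i, Par (Ψ (Φ x) i) (x i))
    (hΦΨ : ∀ x : MultiPt K a, x.Good → ∀ i, Par (Φ (Ψ x) i) (x i))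
    (d : ℕ) (x y : MultiPt K a) (hx : x.Good) (hy : y.Good)
    (hxy : ∀ i, a i = d → Par (x i) (y i)) (j : ι) (hj : a j = d) : Par (Φ x j) (Φ y j) := by
  classical
  choose G hG hG' using hΦ.exists_coprime
  choose F hF hF' using hΨ.exists_coprime
  choose E hE using fun j => hΦ.exists_multidegree (hG j) (hG' j)
  choose E' hE' using fun j => hΨ.exists_multidegree (hF j) (hF' j)
  obtain ⟨t, ht, ht'⟩ := Matrix.exists_perm_of_nat_mul_eq_one E E'
    (multidegree_mul_eq_one ha hΦ hΨ hΨΦ G F hG' hF' E E' hE hE')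
    (multidegree_mul_eq_one ha hΨ hΦ hΦΨ F G hF' hG' E' E hE' hE) j
  obtain ⟨L, hL⟩ := exists_linearMap_of_multidegree (G j) t fun h l => by rw [hE, ht]
  obtain ⟨M, hM⟩ := exists_linearMap_of_multidegree (F t) j fun h l => by rw [hE', ht']
  have hinj : ∀ {i : ι} {N : ℕ} (L : (Fin (a i + 1) → K) →ₗ[K] (Fin N → K)),
      (∀ x : MultiPt K a, x.Good → L (x i) ≠ 0) → Function.Injective L := by
    intro i N L hL
    rw [injective_iff_map_eq_zero]
    intro v hv
    by_contra hne
    refine hL (Function.update (fun _ _ => 1) i v) (fun h => ?_) ?_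
    · by_cases e : h = i
      · subst e; simpa using hne
      · rw [Function.update_of_ne e]
        exact fun h0 => one_ne_zero (congrFun h0 0)
    · simpa using hv
  have h1 := LinearMap.finrank_le_finrank_of_injective (hinj L fun x hx => by
    rw [← hL]; exact (hG' j x hx).1)
  have h2 := LinearMap.finrank_le_finrank_of_injective (hinj M fun x hx => by
    rw [← hM]; exact (hF' t x hx).1)
  simp only [Module.finrank_fintype_fun_eq_card, Fintype.card_fin] at h1 h2
  have hat : a t = d := by omega
  obtain ⟨c, -, hcxy⟩ := (hxy t hat).exists_smul (hx t) (hy t)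
  have hGxy : Par (fun l => x.ev (G j l)) (fun l => y.ev (G j l)) := by
    rw [hL, hL, hcxy, map_smul]
    exact Par.smul_left _ _
  exact ((hG' j x hx).2.symm.trans hGxy (hG' j x hx).1).trans (hG' j y hy).2 (hG' j y hy).1

end

universe u

/-- `P` is a product over `B` of the family `F`, with projections `p`. -/
structure IsProdOver {B : Scheme.{u}} {ι : Type*} (F : ι → (Y : Scheme.{u}) × (Y ⟶ B))
    (P : (Y : Scheme.{u}) × (Y ⟶ B)) (p : ∀ i, P.1 ⟶ (F i).1) : Prop where
  comm : ∀ i, p i ≫ (F i).2 = P.2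
  exists_lift : ∀ (T : Scheme.{u}) (t : T ⟶ B) (q : ∀ i, T ⟶ (F i).1),
    (∀ i, q i ≫ (F i).2 = t) → ∃ l : T ⟶ P.1, l ≫ P.2 = t ∧ ∀ i, l ≫ p i = q i
  hom_ext : ∀ (T : Scheme.{u}) (l l' : T ⟶ P.1), l ≫ P.2 = l' ≫ P.2 →
    (∀ i, l ≫ p i = l' ≫ p i) → l = l'

namespace IsProdOver

variable {B : Scheme.{u}}

lemma cons {n : ℕ} {F : Fin (n + 1) → (Y : Scheme.{u}) × (Y ⟶ B)}
    {P : (Y : Scheme.{u}) × (Y ⟶ B)} {p : ∀ i : Fin n, P.1 ⟶ (F i.succ).1}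
    (hp : IsProdOver (fun i : Fin n => F i.succ) P p) :
    IsProdOver F ⟨pullback (F 0).2 P.2, pullback.fst _ _ ≫ (F 0).2⟩
      (Fin.cons (pullback.fst _ _) fun i => pullback.snd _ _ ≫ p i) where
  comm i := by
    refine Fin.cases rfl (fun i => ?_) i
    simp only [Fin.cons_succ]
    rw [Category.assoc, hp.comm, pullback.condition]
  exists_lift T t q hq := by
    obtain ⟨l, hl, hl'⟩ := hp.exists_lift T t (fun i => q i.succ) fun i => hq _
    refine ⟨pullback.lift (q 0) l (by rw [hq, hl]), ?_, fun i => ?_⟩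
    · dsimp only
      rw [pullback.lift_fst_assoc, hq]
    · refine Fin.cases ?_ (fun i => ?_) i
      · exact pullback.lift_fst _ _ _
      · simp only [Fin.cons_succ]
        exact (pullback.lift_snd_assoc _ _ _ _).trans (hl' i)
  hom_ext T l l' h h' := by
    apply pullback.hom_ext
    · exact h' 0
    · refine hp.hom_ext T _ _ ?_ fun i => ?_
      · dsimp only at h
        rw [pullback.condition] at h
        simpa only [Category.assoc] using h
      · simpa only [Fin.cons_succ, Category.assoc] using h' i.succ

lemma exists_fiberProdList {B : Scheme.{0}} (n : ℕ) (F : Fin n → (Y : Scheme.{0}) × (Y ⟶ B)) :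
    ∃ p, IsProdOver F (fiberProdList B (List.ofFn F)) p := by
  induction n with
  | zero =>
    rw [List.ofFn_zero]
    exact ⟨fun i => i.elim0, fun i => i.elim0,
      fun T t q _ => ⟨t, Category.comp_id t, fun i => i.elim0⟩,
      fun T l l' h _ => (Category.comp_id l).symm.trans (h.trans (Category.comp_id l'))⟩
  | succ n ih =>
    obtain ⟨p, hp⟩ := ih fun i => F i.succ
    rw [List.ofFn_succ]
    exact ⟨_, hp.cons⟩

lemma of_iso {ι : Type*} {F : ι → (Y : Scheme.{u}) × (Y ⟶ B)} {P : (Y : Scheme.{u}) × (Y ⟶ B)}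
    {p : ∀ i, P.1 ⟶ (F i).1} (h : IsProdOver F P p) {X : Scheme.{u}} (e : X ≅ P.1) (x : X ⟶ B)
    (hx : e.hom ≫ P.2 = x) : IsProdOver F ⟨X, x⟩ (fun i => e.hom ≫ p i) where
  comm i := by rw [Category.assoc, h.comm, hx]
  exists_lift T t q hq := by
    obtain ⟨l, hl, hl'⟩ := h.exists_lift T t q hq
    exact ⟨l ≫ e.inv, by simp [← hx, hl], fun i => by simp [hl']⟩
  hom_ext T l l' e1 e2 := by
    rw [← cancel_mono e.hom]
    exact h.hom_ext T _ _ (by simpa [← hx] using e1) fun i => by simpa using e2 i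

lemma exists_reindex {ι κ : Type*} (e : ι ≃ κ) {F : κ → (Y : Scheme.{u}) × (Y ⟶ B)}
    {P : (Y : Scheme.{u}) × (Y ⟶ B)} {p : ∀ i, P.1 ⟶ (F (e i)).1}
    (h : IsProdOver (fun i => F (e i)) P p) : ∃ p', IsProdOver F P p' := by
  refine ⟨Equiv.piCongrLeft (fun k => P.1 ⟶ (F k).1) e p, fun k => ?_, fun T t q hq => ?_,
    fun T l l' h1 h2 => h.hom_ext T l l' h1 fun i => ?_⟩
  · obtain ⟨i, rfl⟩ := e.surjective k
    rw [Equiv.piCongrLeft_apply_apply, h.comm]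
  · obtain ⟨l, hl, hl'⟩ := h.exists_lift T t (fun i => q (e i)) fun i => hq _
    refine ⟨l, hl, fun k => ?_⟩
    obtain ⟨i, rfl⟩ := e.surjective k
    rw [Equiv.piCongrLeft_apply_apply, hl']
  · simpa only [Equiv.piCongrLeft_apply_apply] using h2 (e i)

/-- A product over a disjoint union of two index sets is a fiber product. -/
lemma isPullback_of_compl {ι : Type*} (s : Set ι) {F : ι → (Y : Scheme.{u}) × (Y ⟶ B)}
    {P Z Q : (Y : Scheme.{u}) × (Y ⟶ B)}
    {p : ∀ i, P.1 ⟶ (F i).1} {z : ∀ i : s, Z.1 ⟶ (F i).1}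
    {q : ∀ i : (sᶜ : Set ι), Q.1 ⟶ (F i).1}
    (hP : IsProdOver F P p) (hZ : IsProdOver (fun i : s => F i) Z z)
    (hQ : IsProdOver (fun i : (sᶜ : Set ι) => F i) Q q) :
    ∃ (a : P.1 ⟶ Z.1) (b : P.1 ⟶ Q.1), IsPullback a b Z.2 Q.2 ∧ (∀ i, a ≫ z i = p i) := by
  classical
  obtain ⟨a, ha, ha'⟩ := hZ.exists_lift P.1 P.2 (fun i => p i) fun i => hP.comm _
  obtain ⟨b, hb, hb'⟩ := hQ.exists_lift P.1 P.2 (fun i => p i) fun i => hP.comm _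
  refine ⟨a, b, ⟨⟨by rw [ha, hb]⟩, ⟨PullbackCone.IsLimit.mk _ (fun c => ?_) (fun c => ?_)
    (fun c => ?_) (fun c m h1 h2 => ?_)⟩⟩, ha'⟩
  · exact (hP.exists_lift c.pt (c.fst ≫ Z.2)
      (fun i => if h : i ∈ s then c.fst ≫ z ⟨i, h⟩ else c.snd ≫ q ⟨i, h⟩) (fun i => by
        split_ifs with h
        · rw [Category.assoc, hZ.comm ⟨i, h⟩]
        · rw [Category.assoc, hQ.comm ⟨i, h⟩, c.condition])).choose
  · generalize_proofs h
    obtain ⟨h1, h2⟩ := h.choose_spec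
    refine hZ.hom_ext _ _ _ ?_ fun i => ?_
    · rw [Category.assoc, ha, h1]
    · rw [Category.assoc, ha', h2, dif_pos i.2]
  · generalize_proofs h
    obtain ⟨h1, h2⟩ := h.choose_spec
    refine hQ.hom_ext _ _ _ ?_ fun i => ?_
    · rw [Category.assoc, hb, h1, c.condition]
    · rw [Category.assoc, hb', h2, dif_neg i.2]
  · generalize_proofs h
    obtain ⟨h1', h2'⟩ := h.choose_spec
    refine hP.hom_ext _ _ _ ?_ fun i => ?_
    · rw [h1', ← h1, Category.assoc, ha]
    · rw [h2']
      split_ifs with hi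
      · rw [← h1, Category.assoc, ha' ⟨i, hi⟩]
      · rw [← h2, Category.assoc, hb' ⟨i, hi⟩]

end IsProdOver

/-- Products over finite index types exist. -/
lemma exists_isProdOver {B : Scheme.{0}} {ι : Type*} [Finite ι]
    (F : ι → (Y : Scheme.{0}) × (Y ⟶ B)) :
    ∃ l p, IsProdOver F (fiberProdList B l) p ∧ ∀ Y ∈ l, ∃ i, F i = Y := by
  obtain ⟨n, ⟨e⟩⟩ := Finite.exists_equiv_fin ι
  obtain ⟨p, hp⟩ := IsProdOver.exists_fiberProdList n fun i => F (e.symm i)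
  obtain ⟨p', hp'⟩ := hp.exists_reindex e.symm
  refine ⟨_, p', hp', fun Y hY => ?_⟩
  obtain ⟨i, rfl⟩ := (List.mem_ofFn' _ _).mp hY
  exact ⟨_, rfl⟩

namespace ProjSpace

section Chart

variable {K : Type} [Field K] {b : ℕ}

lemma X_mem (i : Fin (b + 1)) : (X i : MvPolynomial (Fin (b + 1)) K) ∈
    homogeneousSubmodule (Fin (b + 1)) K 1 := isHomogeneous_X K i

variable (K b) in
/-- The coordinate ring of the standard chart `x_j ≠ 0` of projective space. -/
abbrev Chart (j : Fin (b + 1)) : Type :=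
  HomogeneousLocalization.Away (homogeneousSubmodule (Fin (b + 1)) K) (X j)

variable (K) in
/-- The standard chart `x_j ≠ 0` of projective space. -/
noncomputable def chartι (j : Fin (b + 1)) :
    Spec (CommRingCat.of (Chart K b j)) ⟶ ProjSpace K b :=
  Proj.awayι (homogeneousSubmodule (Fin (b + 1)) K) (X j) (X_mem j) one_pos

instance (j : Fin (b + 1)) : IsOpenImmersion (chartι K j) :=
  inferInstanceAs (IsOpenImmersion (Proj.awayι _ _ _ _))

/-- The scalars of a standard chart. -/
noncomputable def chartC (j : Fin (b + 1)) : K →+* Chart K b j :=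
  (HomogeneousLocalization.fromZeroRingHom (homogeneousSubmodule (Fin (b + 1)) K) _).comp
    (algebraMap K (homogeneousSubmodule (Fin (b + 1)) K 0))

/-- The coordinate functions `x_i / x_j` of a standard chart. -/
noncomputable def chartX (j i : Fin (b + 1)) : Chart K b j :=
  HomogeneousLocalization.Away.mk _ (X_mem j) 1 (X i) (by simpa using X_mem i)

lemma chartι_structMor (j : Fin (b + 1)) :
    chartι K j ≫ structMor K b = Spec.map (CommRingCat.ofHom (chartC j)) := by
  unfold chartι structMor
  erw [Proj.awayι_toSpecZero_assoc]
  rw [← Spec.map_comp, ← CommRingCat.ofHom_comp]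
  rfl

lemma eval₂_mul_of_isHomogeneous {σ R S : Type*} [CommRing R] [CommRing S] (θ : R →+* S)
    (c : S) (v : σ → S) {F : MvPolynomial σ R} {n : ℕ} (hF : F.IsHomogeneous n) :
    eval₂ θ (fun i => c * v i) F = c ^ n * eval₂ θ v F := by
  rw [eval₂_eq, eval₂_eq, Finset.mul_sum]
  refine Finset.sum_congr rfl fun d hd => ?_
  have h := hF (mem_support_iff.mp hd)
  rw [← h, Finsupp.weight_apply, Finsupp.sum]
  simp only [Pi.one_apply, smul_eq_mul, mul_one, mul_pow, Finset.prod_mul_distrib,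
    Finset.prod_pow_eq_pow_sum]
  ring

variable {R : Type} [CommRing R]

variable (K b) in
/-- The homogeneous coordinate ring with one coordinate inverted. -/
abbrev ChartLoc (j : Fin (b + 1)) : Type :=
  Localization.Away (X j : MvPolynomial (Fin (b + 1)) K)

lemma algebraMap_mk_mul (j : Fin (b + 1)) (n : ℕ) (F : MvPolynomial (Fin (b + 1)) K) (hF) :
    algebraMap (Chart K b j) (ChartLoc K b j)
      (HomogeneousLocalization.Away.mk _ (X_mem j) n F hF) *
        algebraMap (MvPolynomial (Fin (b + 1)) K) (ChartLoc K b j) (X j) ^ n =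
      algebraMap (MvPolynomial (Fin (b + 1)) K) (ChartLoc K b j) F := by
  rw [HomogeneousLocalization.algebraMap_apply, HomogeneousLocalization.Away.val_mk,
    Localization.mk_eq_mk', ← map_pow]
  exact IsLocalization.mk'_spec (ChartLoc K b j) F
    (⟨X j ^ n, n, rfl⟩ : Submonoid.powers (X j : MvPolynomial (Fin (b + 1)) K))

lemma isUnit_algebraMap_X (j : Fin (b + 1)) :
    IsUnit (algebraMap (MvPolynomial (Fin (b + 1)) K) (ChartLoc K b j) (X j)) :=
  IsLocalization.Away.algebraMap_isUnit _

/-- Evaluation of functions on a standard chart at a point given in homogeneous coordinates. -/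
noncomputable def chartEval (θ : K →+* R) (v : Fin (b + 1) → R) (j : Fin (b + 1))
    (hj : IsUnit (v j)) : Chart K b j →+* R :=
  (IsLocalization.Away.lift (S := ChartLoc K b j) (X j)
    (g := eval₂Hom θ v) (by simpa)).comp (algebraMap (Chart K b j) (ChartLoc K b j))

lemma chartEval_mk (θ : K →+* R) (v : Fin (b + 1) → R) (j : Fin (b + 1))
    (hj : IsUnit (v j)) (n : ℕ) (F : MvPolynomial (Fin (b + 1)) K) (hF) :
    chartEval θ v j hj (HomogeneousLocalization.Away.mk _ (X_mem j) n F hF) * v j ^ n =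
      eval₂ θ v F := by
  have hX : IsUnit (eval₂Hom θ v (X j)) := by simpa
  have := congrArg (IsLocalization.Away.lift (X j) (g := eval₂Hom θ v) hX)
    (algebraMap_mk_mul j n F hF)
  rw [map_mul, map_pow, IsLocalization.Away.lift_eq, IsLocalization.Away.lift_eq] at this
  simpa [chartEval] using this

lemma chartC_eq (j : Fin (b + 1)) (c : K) : chartC j c =
    HomogeneousLocalization.Away.mk _ (X_mem j) 0 (C c) (by simp) := by
  apply HomogeneousLocalization.val_injective
  rw [HomogeneousLocalization.Away.val_mk]
  rfl

lemma chartEval_chartC (θ : K →+* R) (v : Fin (b + 1) → R) (j : Fin (b + 1))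
    (hj : IsUnit (v j)) (c : K) : chartEval θ v j hj (chartC j c) = θ c := by
  have := chartEval_mk θ v j hj 0 (C c) (by simp)
  rw [pow_zero, mul_one, eval₂_C] at this
  rw [← this, chartC_eq]

lemma chartEval_chartX (θ : K →+* R) (v : Fin (b + 1) → R) (j : Fin (b + 1))
    (hj : IsUnit (v j)) (i) : chartEval θ v j hj (chartX j i) * v j = v i := by
  have := chartEval_mk θ v j hj 1 (X i) (by simpa using X_mem i)
  rw [pow_one, eval₂_X] at this
  exact this

lemma chart_mk_eq (j : Fin (b + 1)) (n : ℕ) (F : MvPolynomial (Fin (b + 1)) K) (hF) :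
    HomogeneousLocalization.Away.mk _ (X_mem j) n F hF = eval₂ (chartC j) (chartX j) F := by
  have hinj : Function.Injective (algebraMap (Chart K b j) (ChartLoc K b j)) := fun x y h =>
    HomogeneousLocalization.val_injective _ (by
      rwa [HomogeneousLocalization.algebraMap_apply,
        HomogeneousLocalization.algebraMap_apply] at h)
  apply hinj
  apply ((isUnit_algebraMap_X (K := K) j).pow n).mul_right_cancel
  rw [algebraMap_mk_mul, hom_eval₂, mul_comm,
    ← eval₂_mul_of_isHomogeneous _ _ _ (by simpa using hF)]
  have h2 : ∀ i, algebraMap (MvPolynomial (Fin (b + 1)) K) (ChartLoc K b j) (X j) *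
      (algebraMap (Chart K b j) (ChartLoc K b j) ∘ chartX j) i =
        algebraMap (MvPolynomial (Fin (b + 1)) K) (ChartLoc K b j) (X i) := fun i => by
    have := algebraMap_mk_mul j 1 (X i) (by simpa using X_mem (K := K) i)
    rw [pow_one] at this
    rw [mul_comm]
    exact this
  refine .trans ?_ (congrArg (fun v => eval₂ _ v F) (funext fun i => (h2 i).symm))
  have : (algebraMap (Chart K b j) (ChartLoc K b j)).comp
    (chartC j) = (algebraMap (MvPolynomial (Fin (b + 1)) K) (ChartLoc K b j)).comp C := rfl
  rw [this, ← hom_eval₂, eval₂_eta]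

lemma chart_ringHom_ext {j : Fin (b + 1)} {φ ψ : Chart K b j →+* R}
    (h1 : φ.comp (chartC j) = ψ.comp (chartC j)) (h2 : ∀ i, φ (chartX j i) = ψ (chartX j i)) :
    φ = ψ := by
  ext x
  obtain ⟨n, F, hF, rfl⟩ := HomogeneousLocalization.Away.mk_surjective _ (X_mem j) x
  rw [chart_mk_eq, hom_eval₂, hom_eval₂, h1]
  congr 1
  ext i
  exact h2 i

lemma chartX_self (j : Fin (b + 1)) : chartX (K := K) j j = 1 := by
  apply HomogeneousLocalization.val_injective
  rw [chartX, HomogeneousLocalization.Away.val_mk, HomogeneousLocalization.val_one]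
  simp

lemma eq_chartEval {j : Fin (b + 1)} (φ : Chart K b j →+* R) :
    φ = chartEval (φ.comp (chartC j)) (φ ∘ chartX j) j (by simp [chartX_self]) := by
  refine chart_ringHom_ext ?_ fun i => ?_
  · ext c
    simp [chartEval_chartC]
  · have := chartEval_chartX (φ.comp (chartC j)) (φ ∘ chartX j) j (by simp [chartX_self]) i
    simpa [chartX_self] using this.symm

lemma chartEval_ext {θ : K →+* R} {v w : Fin (b + 1) → R} {j : Fin (b + 1)}
    (hv : IsUnit (v j)) (hw : IsUnit (w j)) (h : ∀ i, v i * w j = v j * w i) :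
    chartEval θ v j hv = chartEval θ w j hw := by
  refine chart_ringHom_ext ?_ fun i => ?_
  · ext c
    simp [chartEval_chartC]
  · apply (hv.mul hw).mul_right_cancel
    rw [← mul_assoc, chartEval_chartX, h, mul_comm (v j) (w j), ← mul_assoc, chartEval_chartX,
      mul_comm]

lemma comp_chartEval {R' : Type} [CommRing R'] (g : R →+* R') (θ : K →+* R)
    (v : Fin (b + 1) → R) (j : Fin (b + 1)) (hj : IsUnit (v j)) :
    g.comp (chartEval θ v j hj) = chartEval (g.comp θ) (g ∘ v) j (hj.map g) := by
  refine chart_ringHom_ext ?_ fun i => ?_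
  · ext c
    simp [chartEval_chartC]
  · apply (hj.map g).mul_right_cancel
    have h := chartEval_chartX (g.comp θ) (g ∘ v) j (hj.map g) i
    rw [Function.comp_apply, Function.comp_apply] at h
    rw [h, RingHom.comp_apply, ← map_mul, chartEval_chartX]

end Chart

end ProjSpace

namespace ProjSpace

variable {K : Type} [Field K] {b : ℕ} {R : Type} [CommRing R]

/-- The morphism to projective space given by homogeneous coordinates, the `j`-th of which
is a unit. -/
noncomputable def pt (θ : K →+* R) (v : Fin (b + 1) → R) (j : Fin (b + 1))
    (hj : IsUnit (v j)) : Spec (CommRingCat.of R) ⟶ ProjSpace K b :=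
  Spec.map (CommRingCat.ofHom (chartEval θ v j hj)) ≫ chartι K j

lemma pt_structMor (θ : K →+* R) (v : Fin (b + 1) → R) (j : Fin (b + 1))
    (hj : IsUnit (v j)) : pt θ v j hj ≫ structMor K b = Spec.map (CommRingCat.ofHom θ) := by
  rw [pt, Category.assoc, chartι_structMor, ← Spec.map_comp, ← CommRingCat.ofHom_comp]
  congr 2
  ext c
  exact chartEval_chartC θ v j hj c

lemma SpecMap_pt {R' : Type} [CommRing R'] (g : R →+* R') (θ : K →+* R)
    (v : Fin (b + 1) → R) (j : Fin (b + 1)) (hj : IsUnit (v j)) :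
    Spec.map (CommRingCat.ofHom g) ≫ pt θ v j hj = pt (g.comp θ) (g ∘ v) j (hj.map g) := by
  rw [pt, pt, ← Category.assoc, ← Spec.map_comp, ← CommRingCat.ofHom_comp, comp_chartEval]

lemma exists_chartEval_awayMap (θ : K →+* R) (v : Fin (b + 1) → R) (j j' : Fin (b + 1))
    (hj : IsUnit (v j)) (hj' : IsUnit (v j')) :
    ∃ φ : HomogeneousLocalization.Away (homogeneousSubmodule (Fin (b + 1)) K)
        (X j * X j') →+* R,
      φ.comp (HomogeneousLocalization.awayMap _ (X_mem j') rfl) = chartEval θ v j hj ∧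
      φ.comp (HomogeneousLocalization.awayMap _ (X_mem j) (mul_comm _ _)) =
        chartEval θ v j' hj' := by
  have hx : IsUnit (eval₂Hom θ v (X j * X j')) := by simpa using ⟨hj, hj'⟩
  let ψ := IsLocalization.Away.lift
    (S := Localization.Away (X j * X j' : MvPolynomial (Fin (b + 1)) K)) (X j * X j')
    (g := eval₂Hom θ v) hx
  refine ⟨ψ.comp (algebraMap _ _), ?_, ?_⟩
  · rw [chartEval, RingHom.comp_assoc]
    ext x
    simp only [RingHom.comp_apply, HomogeneousLocalization.algebraMap_apply,
      HomogeneousLocalization.val_awayMap]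
    rw [← RingHom.comp_apply]
    congr 1
    refine IsLocalization.ringHom_ext
      (Submonoid.powers (X j : MvPolynomial (Fin (b + 1)) K)) ?_
    ext <;> simp [ψ, Localization.awayLift]
  · rw [chartEval, RingHom.comp_assoc]
    ext x
    simp only [RingHom.comp_apply, HomogeneousLocalization.algebraMap_apply,
      HomogeneousLocalization.val_awayMap]
    rw [← RingHom.comp_apply]
    congr 1
    refine IsLocalization.ringHom_ext
      (Submonoid.powers (X j' : MvPolynomial (Fin (b + 1)) K)) ?_
    ext <;> simp [ψ, Localization.awayLift]

lemma pt_eq_of_isUnit (θ : K →+* R) (v : Fin (b + 1) → R) (j j' : Fin (b + 1))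
    (hj : IsUnit (v j)) (hj' : IsUnit (v j')) : pt θ v j hj = pt θ v j' hj' := by
  obtain ⟨φ, h, h'⟩ := exists_chartEval_awayMap θ v j j' hj hj'
  rw [pt, pt, ← h, ← h', CommRingCat.ofHom_comp, CommRingCat.ofHom_comp, Spec.map_comp,
    Spec.map_comp, Category.assoc, Category.assoc]
  congr 1
  exact (Proj.SpecMap_awayMap_awayι _ (X_mem j) one_pos (X_mem j') rfl).trans
    (Proj.SpecMap_awayMap_awayι _ (X_mem j') one_pos (X_mem j) (mul_comm _ _)).symm

lemma pt_ext (θ : K →+* R) {v w : Fin (b + 1) → R} {j j' : Fin (b + 1)}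
    (hv : IsUnit (v j)) (hw : IsUnit (w j')) (h : Par v w) : pt θ v j hv = pt θ w j' hw := by
  have hw' : IsUnit (w j) := by
    have h1 := h j j'
    exact isUnit_of_mul_isUnit_right (h1 ▸ hv.mul hw)
  rw [pt_eq_of_isUnit θ w j' j hw hw', pt, pt, chartEval_ext hv hw' fun i => h i j]

lemma iSup_basicOpen_X : ⨆ i : Fin (b + 1),
    Proj.basicOpen (homogeneousSubmodule (Fin (b + 1)) K) (X i) = ⊤ := by
  refine Proj.iSup_basicOpen_eq_top' _ _ (fun i => ⟨1, X_mem i⟩) ?_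
  rw [eq_top_iff]
  intro F _
  have h : F ∈ Algebra.adjoin K (Set.range (X : Fin (b + 1) → MvPolynomial (Fin (b + 1)) K)) := by
    rw [MvPolynomial.adjoin_range_X]; trivial
  induction h using Algebra.adjoin_induction with
  | mem x hx => exact Algebra.subset_adjoin hx
  | algebraMap r =>
    exact Subalgebra.algebraMap_mem _ (⟨C r, isHomogeneous_C _ r⟩ :
      homogeneousSubmodule (Fin (b + 1)) K 0)
  | add x y _ _ hx hy => exact add_mem (hx trivial) (hy trivial)
  | mul x y _ _ hx hy => exact mul_mem (hx trivial) (hy trivial)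

lemma exists_mem_range_chartι (x : ProjSpace K b) : ∃ j, x ∈ Set.range (chartι K (b := b) j) := by
  have : x ∈ ⨆ i : Fin (b + 1),
    Proj.basicOpen (homogeneousSubmodule (Fin (b + 1)) K) (X i) := by
    rw [iSup_basicOpen_X]; trivial
  obtain ⟨j, hj⟩ := TopologicalSpace.Opens.mem_iSup.mp this
  refine ⟨j, ?_⟩
  rw [← Proj.opensRange_awayι _ (X j) (X_mem j) one_pos] at hj
  exact hj

/-- Morphisms from affine schemes to projective space are locally given by homogeneous
coordinates. -/
lemma exists_pt (h : Spec (CommRingCat.of R) ⟶ ProjSpace K b) (θ : K →+* R)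
    (hθ : h ≫ structMor K b = Spec.map (CommRingCat.ofHom θ)) (x : Spec (CommRingCat.of R)) :
    ∃ (f : R) (j : Fin (b + 1)) (v : Fin (b + 1) → Localization.Away f) (hv : v j = 1),
      f ∉ x.asIdeal ∧ Spec.map (CommRingCat.ofHom (algebraMap R (Localization.Away f))) ≫ h =
        pt ((algebraMap R (Localization.Away f)).comp θ) v j (hv ▸ isUnit_one) := by
  obtain ⟨j, hj⟩ := exists_mem_range_chartι (h x)
  obtain ⟨f, hf, hfj⟩ : ∃ f : R, f ∉ x.asIdeal ∧
      (PrimeSpectrum.basicOpen f : Set (PrimeSpectrum R)) ⊆ h ⁻¹' Set.range (chartι K j) := by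
    have ho : IsOpen (h ⁻¹' Set.range (chartι K j)) :=
      (chartι K j).isOpenEmbedding.isOpen_range.preimage h.continuous
    obtain ⟨_, ⟨f, rfl⟩, h1, h2⟩ :=
      PrimeSpectrum.isTopologicalBasis_basic_opens.exists_subset_of_mem_open hj ho
    exact ⟨f, h1, h2⟩
  let φ := Spec.map (CommRingCat.ofHom (algebraMap R (Localization.Away f)))
  have hr : Set.range (φ ≫ h) ⊆ Set.range (chartι K j) := by
    rintro _ ⟨y, rfl⟩
    refine hfj ?_
    rw [← PrimeSpectrum.localization_away_comap_range (Localization.Away f) f]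
    exact ⟨y, rfl⟩
  obtain ⟨α, hα⟩ := Spec.map_surjective (IsOpenImmersion.lift (chartι K j) (φ ≫ h) hr)
  have h1 : Spec.map α ≫ chartι K j = φ ≫ h := by rw [hα, IsOpenImmersion.lift_fac]
  have h2 : α.hom.comp (chartC j) = (algebraMap R (Localization.Away f)).comp θ := by
    have := congrArg (· ≫ structMor K b) h1
    simp only [Category.assoc, hθ, chartι_structMor, φ, ← Spec.map_comp] at this
    exact congrArg CommRingCat.Hom.hom (Spec.map_injective this)
  refine ⟨f, j, α.hom ∘ chartX j, by simp [chartX_self], hf, ?_⟩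
  change φ ≫ h = _
  rw [← h1, pt]
  congr 2
  ext1
  rw [CommRingCat.hom_ofHom]
  simp only [← h2]
  exact eq_chartEval α.hom

lemma exists_pt_of_field {L : Type} [Field L] (h : Spec (CommRingCat.of L) ⟶ ProjSpace K b)
    (θ : K →+* L) (hθ : h ≫ structMor K b = Spec.map (CommRingCat.ofHom θ)) :
    ∃ (v : Fin (b + 1) → L) (j : Fin (b + 1)) (hj : IsUnit (v j)), h = pt θ v j hj := by
  obtain ⟨f, j, v, hv, hf, e⟩ := exists_pt h θ hθ (⊥ : PrimeSpectrum L)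
  have hf' : IsUnit f := isUnit_iff_ne_zero.mpr fun h0 => hf (by rw [h0]; exact zero_mem _)
  let g : Localization.Away f →+* L := IsLocalization.Away.lift f (g := RingHom.id L) hf'
  have hg : g.comp (algebraMap L _) = RingHom.id L := IsLocalization.Away.lift_comp ..
  refine ⟨g ∘ v, j, by simp [hv], ?_⟩
  have := congrArg (Spec.map (CommRingCat.ofHom g) ≫ ·) e
  simp only [SpecMap_pt, ← Category.assoc, ← Spec.map_comp, ← CommRingCat.ofHom_comp,
    ← RingHom.comp_assoc, hg, RingHom.id_comp, CommRingCat.ofHom_id, Spec.map_id] at this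
  rw [← this, Category.id_comp]

lemma chartι_preimage_range (j j' : Fin (b + 1)) (x : Spec (CommRingCat.of (Chart K b j))) :
    chartι K j x ∈ Set.range (chartι K (b := b) j') ↔ chartX j j' ∉ x.asIdeal := by
  have h := Proj.awayι_preimage_basicOpen (homogeneousSubmodule (Fin (b + 1)) K)
    (X_mem j) one_pos (X_mem j') one_pos
  have h2 : chartι K j x ∈ Set.range (chartι K (b := b) j') ↔
      x ∈ PrimeSpectrum.basicOpen (HomogeneousLocalization.Away.isLocalizationElem
        (X_mem (K := K) j) (X_mem j')) := by
    rw [← h]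
    change _ ↔ chartι K j x ∈ Proj.basicOpen _ _
    rw [← Proj.opensRange_awayι _ (X j') (X_mem j') one_pos]
    rfl
  refine h2.trans ((PrimeSpectrum.mem_basicOpen _ _).trans ?_)
  have : HomogeneousLocalization.Away.isLocalizationElem (X_mem (K := K) j) (X_mem j') =
      chartX j j' := by
    apply HomogeneousLocalization.val_injective
    simp [chartX, HomogeneousLocalization.Away.isLocalizationElem]
  rw [this]

lemma par_of_pt_eq {L : Type} [Field L] {θ : K →+* L} {v w : Fin (b + 1) → L} {j j' : Fin (b + 1)}
    (hv : IsUnit (v j)) (hw : IsUnit (w j')) (h : pt θ v j hv = pt θ w j' hw) : Par v w := by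
  have hv' : v j' ≠ 0 := by
    intro h0
    have h1 : pt θ v j hv (⊥ : PrimeSpectrum L) ∈ Set.range (chartι K (b := b) j') := by
      rw [h]
      exact ⟨_, rfl⟩
    have h2 := (chartι_preimage_range j j' (Spec.map (CommRingCat.ofHom (chartEval θ v j hv))
      (⊥ : PrimeSpectrum L))).mp h1
    refine h2 ?_
    change chartEval θ v j hv (chartX j j') ∈ (⊥ : Ideal L)
    have := chartEval_chartX θ v j hv j'
    rw [h0] at this
    simpa [hv.ne_zero] using this
  have hv'' : IsUnit (v j') := isUnit_iff_ne_zero.mpr hv'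
  rw [pt_eq_of_isUnit θ v j j' hv hv'', pt, pt, cancel_mono] at h
  have h3 := congrArg CommRingCat.Hom.hom (Spec.map_injective h)
  simp only [CommRingCat.hom_ofHom] at h3
  have h4 : ∀ i, v i * w j' = v j' * w i := fun i => by
    rw [← chartEval_chartX θ v j' hv'' i, ← chartEval_chartX θ w j' hw i, h3]
    ring
  intro l m
  apply mul_left_cancel₀ (mul_ne_zero hv' hw.ne_zero)
  linear_combination v j' * w m * h4 l - v j' * w l * h4 m

end ProjSpace

/-- Morphisms on a family of open subschemes which covers `X` glue, provided that they agree on a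
basis of the pairwise intersections. -/
lemma exists_glueMorphisms {X T : Scheme.{0}} {J : Type} (U : J → X.Opens)
    (hU : ∀ x : X, ∃ j, x ∈ U j) (g : ∀ j, (U j).toScheme ⟶ T)
    (hg : ∀ i j x, x ∈ U i → x ∈ U j → ∃ (k : J) (hi : U k ≤ U i) (hj : U k ≤ U j),
      x ∈ U k ∧ X.homOfLE hi ≫ g i = X.homOfLE hj ≫ g j) :
    ∃ l : X ⟶ T, ∀ j, (U j).ι ≫ l = g j := by
  let 𝒰 := X.openCoverOfIsOpenCover U (TopologicalSpace.IsOpenCover.mk (eq_top_iff.2 fun x _ =>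
    TopologicalSpace.Opens.mem_iSup.2 (hU x)))
  refine ⟨𝒰.glueMorphisms g fun i j => ?_, fun j => 𝒰.ι_glueMorphisms g _ j⟩
  apply Scheme.hom_ext_of_forall
  intro x
  let p := pullback.fst (U i).ι (U j).ι
  let q := pullback.snd (U i).ι (U j).ι
  have hpq : p ≫ (U i).ι = q ≫ (U j).ι := pullback.condition
  obtain ⟨k, hi, hj, hk, e⟩ := hg i j ((p ≫ (U i).ι) x) (p x).2 (by
    rw [hpq]; exact (q x).2)
  let W := (p ≫ (U i).ι) ⁻¹ᵁ U k
  let t : W.toScheme ⟶ (U k).toScheme := IsOpenImmersion.lift (U k).ι (W.ι ≫ p ≫ (U i).ι) (by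
    rintro _ ⟨w, rfl⟩
    rw [Scheme.Opens.range_ι]
    exact w.2)
  have ht : t ≫ (U k).ι = W.ι ≫ p ≫ (U i).ι := IsOpenImmersion.lift_fac _ _ _
  refine ⟨W, hk, ?_⟩
  have h1 : W.ι ≫ p = t ≫ X.homOfLE hi := by
    rw [← cancel_mono (U i).ι, Category.assoc, Category.assoc, Scheme.homOfLE_ι, ht]
  have h2 : W.ι ≫ q = t ≫ X.homOfLE hj := by
    rw [← cancel_mono (U j).ι, Category.assoc, Category.assoc, Scheme.homOfLE_ι, ht, hpq]
  change W.ι ≫ p ≫ g i = W.ι ≫ q ≫ g j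
  rw [← Category.assoc, h1, ← Category.assoc, h2, Category.assoc, Category.assoc, e]

lemma Scheme.hom_ext_of_openCover_opens {X T : Scheme.{0}} {J : Type} (U : J → X.Opens)
    (hU : ∀ x : X, ∃ j, x ∈ U j) {f g : X ⟶ T} (h : ∀ j, (U j).ι ≫ f = (U j).ι ≫ g) : f = g :=
  (X.openCoverOfIsOpenCover U (TopologicalSpace.IsOpenCover.mk (eq_top_iff.2 fun x _ =>
    TopologicalSpace.Opens.mem_iSup.2 (hU x)))).hom_ext _ _ h

lemma exists_of_isPullback {P X Y S : Scheme.{0}} {p : P ⟶ X} {q : P ⟶ Y} {f : X ⟶ S} {g : Y ⟶ S}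
    (h : IsPullback p q f g) (x : X) (y : Y) (hxy : f x = g y) : ∃ w, p w = x ∧ q w = y := by
  obtain ⟨w, hw, hw'⟩ := Scheme.Pullback.exists_preimage_pullback x y hxy
  refine ⟨h.isoPullback.inv w, ?_, ?_⟩
  · rw [← Scheme.Hom.comp_apply, h.isoPullback_inv_fst, hw]
  · rw [← Scheme.Hom.comp_apply, h.isoPullback_inv_snd, hw']

/-- Gluing along a descending family of open subschemes. -/
theorem exists_glue_of_isPullback {Z B B' : Scheme.{0}} (b : B' ⟶ B) [Surjective b] [Flat b]
    [QuasiCompact b] (z : Z ⟶ B') {J : Type} [Preorder J] (V : J → Z.Opens)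
    (hV : Monotone V) (hcov : ∀ x : Z, ∃ j, x ∈ V j)
    (hdir : ∀ i j x, x ∈ V i → x ∈ V j → ∃ k, k ≤ i ∧ k ≤ j ∧ x ∈ V k)
    (F : J ⥤ Scheme.{0}) (g : ∀ j, F.obj j ⟶ B) (hg : ∀ {i j} (h : i ⟶ j), F.map h ≫ g j = g i)
    (β : ∀ j, (V j).toScheme ⟶ F.obj j)
    (hβ : ∀ {i j} (h : i ⟶ j), Z.homOfLE (hV (leOfHom h)) ≫ β j = β i ≫ F.map h)
    (hpb : ∀ j, IsPullback (β j) ((V j).ι ≫ z) (g j) b) :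
    ∃ (Y : Scheme.{0}) (gY : Y ⟶ B) (βY : Z ⟶ Y) (ι : ∀ j, F.obj j ⟶ Y),
      IsPullback βY z gY b ∧ (∀ j, ι j ≫ gY = g j) ∧ (∀ {i j} (h : i ⟶ j), F.map h ≫ ι j = ι i) ∧
      ∀ j, (V j).ι ≫ βY = β j ≫ ι j := by
  have hβQ (j) : (@Surjective ⊓ @Flat ⊓ @QuasiCompact : MorphismProperty Scheme.{0}) (β j) :=
    ⟨⟨MorphismProperty.of_isPullback (hpb j).flip ‹_›,
      MorphismProperty.of_isPullback (hpb j).flip ‹_›⟩,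
      MorphismProperty.of_isPullback (hpb j).flip ‹_›⟩
  have hβs (j) : Function.Surjective (β j) := (hβQ j).1.1.surj
  have hsq {i j : J} (h : i ⟶ j) :
      IsPullback (β i) (Z.homOfLE (hV (leOfHom h))) (F.map h) (β j) := by
    refine IsPullback.of_bot (h₃₁ := b) (v₂₁ := (V j).ι ≫ z) (v₂₂ := g j) ?_ ?_ (hpb j)
    · rw [Scheme.homOfLE_ι_assoc, hg]
      exact hpb i
    · exact (hβ h).symm
  have hoi {i j : J} (h : i ⟶ j) : IsOpenImmersion (F.map h) :=
    MorphismProperty.of_isPullback_of_descendsAlong (P := @IsOpenImmersion) (hsq h).flip (hβQ j)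
      inferInstance
  have hbp {i j : J} (h : i ⟶ j) (x : Z) (hx : x ∈ V i) :
      F.map h (β i ⟨x, hx⟩) = β j ⟨x, hV (leOfHom h) hx⟩ := by
    exact (Scheme.Hom.comp_apply (β i) (F.map h) _).symm.trans
      ((congr($(hβ h) (⟨x, hx⟩ : V i))).symm.trans ((Scheme.Hom.comp_apply _ _ _).trans
        (congrArg (β j) (Subtype.ext (Scheme.homOfLE_apply _ _)))))
  have hmem {i j : J} (h : i ⟶ j) (x : Z) (hx : x ∈ V j) (y : F.obj i)
      (hy : F.map h y = β j ⟨x, hx⟩) : x ∈ V i := by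
    obtain ⟨w, -, hw⟩ := exists_of_isPullback (hsq h) y (⟨x, hx⟩ : V j) hy
    have := congrArg (V j).ι hw
    rw [← Scheme.Hom.comp_apply, Scheme.homOfLE_ι] at this
    change _ = x at this
    rw [← this]
    exact w.2
  have hdirF : (F ⋙ Scheme.forget).IsLocallyDirected := by
    refine ⟨fun {i j k} fi fj xi xj heq => ?_⟩
    change F.map fi xi = F.map fj xj at heq
    obtain ⟨⟨v, hv⟩, rfl⟩ := hβs i xi
    have h1 := heq.symm.trans (hbp fi v hv)
    have h2 := hmem fj _ _ _ h1
    obtain ⟨l, hli, hlj, hl⟩ := hdir i j v hv h2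
    refine ⟨l, homOfLE hli, homOfLE hlj, β l ⟨v, hl⟩, hbp (homOfLE hli) v hl,
      (hbp (homOfLE hlj) v hl).trans ((F.map fj).isOpenEmbedding.injective ?_)⟩
    exact (hbp fj v h2).trans h1.symm
  obtain ⟨βY, hβY⟩ := exists_glueMorphisms V hcov (fun j => β j ≫ colimit.ι F j)
    fun i j x hi hj => by
      obtain ⟨k, hki, hkj, hk⟩ := hdir i j x hi hj
      refine ⟨k, hV hki, hV hkj, hk, ?_⟩
      rw [← Category.assoc, ← Category.assoc, hβ (homOfLE hki), hβ (homOfLE hkj),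
        Category.assoc, Category.assoc, colimit.w, colimit.w]
  let c : Cocone F := Cocone.mk B (NatTrans.mk g fun i j h =>
    (hg h).trans (Category.comp_id (g i)).symm)
  let gY : colimit F ⟶ B := colimit.desc F c
  have hgY (j) : colimit.ι F j ≫ gY = g j := colimit.ι_desc _ _
  refine ⟨colimit F, gY, βY, colimit.ι F, ?_, hgY, fun h => colimit.w F h, hβY⟩
  have hw : βY ≫ gY = z ≫ b := by
    refine Scheme.hom_ext_of_openCover_opens V hcov fun j => ?_
    rw [← Category.assoc, hβY, Category.assoc, hgY, (hpb j).w, Category.assoc]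
  have hpre (j) : IsPullback (β j) (V j).ι (colimit.ι F j) βY := by
    refine IsOpenImmersion.isPullback _ _ _ _ (hβY j) ?_
    rw [Scheme.Opens.opensRange_ι]
    ext x
    obtain ⟨i, hi⟩ := hcov x
    have hx (i) (hi : x ∈ V i) : βY x = colimit.ι F i (β i ⟨x, hi⟩) := by
      exact (Scheme.Hom.comp_apply (V i).ι βY (⟨x, hi⟩ : V i)).symm.trans
        ((congr($(hβY i) (⟨x, hi⟩ : V i))).trans (Scheme.Hom.comp_apply _ _ _))
    constructor
    · rintro ⟨y, hy⟩
      rw [hx i hi] at hy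
      obtain ⟨k, fj, fi, w, hw, hw'⟩ := (Scheme.IsLocallyDirected.ι_eq_ι_iff F).1 hy
      exact hV (leOfHom fj) (hmem fi x hi w hw')
    · intro hj
      exact ⟨_, (hx j hj).symm⟩
  let d : Z ⟶ pullback gY b := pullback.lift βY z hw
  have h1 (j) : IsPullback ((V j).ι ≫ d) (β j) (pullback.fst gY b) (colimit.ι F j) := by
    refine IsPullback.of_right (h₁₂ := pullback.snd gY b) (v₁₃ := b) (h₂₂ := gY) ?_ ?_
      (IsPullback.of_hasPullback gY b).flip
    · rw [Category.assoc, pullback.lift_snd, hgY]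
      exact (hpb j).flip
    · rw [Category.assoc, pullback.lift_fst, hβY]
  have h2 (j) : IsOpenImmersion ((V j).ι ≫ d) :=
    MorphismProperty.of_isPullback (P := @IsOpenImmersion) (h1 j).flip inferInstance
  have h3 (j) : d ⁻¹ᵁ ((V j).ι ≫ d).opensRange = V j := by
    refine le_antisymm (fun x hx => ?_) fun x hx => ⟨⟨x, hx⟩, Scheme.Hom.comp_apply _ _ _⟩
    obtain ⟨y, hy⟩ := hx
    have e := congrArg (pullback.fst gY b) hy
    rw [← Scheme.Hom.comp_apply, ← Scheme.Hom.comp_apply, Category.assoc, pullback.lift_fst,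
      hβY, Scheme.Hom.comp_apply] at e
    obtain ⟨w, -, hw⟩ := exists_of_isPullback (hpre j) _ _ e
    rw [← hw]
    exact w.2
  have h4 : IsOpenImmersion d := by
    refine IsZariskiLocalAtTarget.of_forall_source_exists_preimage d fun x => ?_
    obtain ⟨j, hj⟩ := hcov x
    refine ⟨((V j).ι ≫ d).opensRange, ⟨⟨x, hj⟩, Scheme.Hom.comp_apply _ _ _⟩, ?_⟩
    rw [h3]
    exact h2 j
  have h5 : Surjective d := by
    refine ⟨fun p => ?_⟩
    obtain ⟨j, y, hy⟩ := Scheme.IsLocallyDirected.ι_jointly_surjective F (pullback.fst gY b p)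
    obtain ⟨v, hv, -⟩ := exists_of_isPullback (h1 j) _ _ hy.symm
    exact ⟨_, (Scheme.Hom.comp_apply _ _ _).symm.trans hv⟩
  have h6 : IsIso d := (AlgebraicGeometry.isIso_iff_isOpenImmersion_and_epi_base d).2 ⟨h4, by
    rw [TopCat.epi_iff_surjective]; exact h5.surj⟩
  exact IsPullback.of_iso_pullback ⟨hw⟩ (asIso d) (pullback.lift_fst _ _ _)
    (pullback.lift_snd _ _ _)

lemma exists_finset_closed_subcover {T ι : Type*} [TopologicalSpace T]
    [TopologicalSpace.NoetherianSpace T] [QuasiSober T] {E : Set T} (hE : IsClosed E)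
    (F : ι → Set T) (hF : ∀ i, IsClosed (F i)) (h : E ⊆ ⋃ i, F i) :
    ∃ t : Finset ι, E ⊆ ⋃ i ∈ t, F i := by
  classical
  obtain ⟨S, hS, hS1, hS2, rfl⟩ :=
    TopologicalSpace.NoetherianSpace.exists_finite_set_isClosed_irreducible hE
  have key (s : S) : ∃ i, s.1 ⊆ F i := by
    obtain ⟨x, hx⟩ := QuasiSober.sober (hS2 s.1 s.2) (hS1 s.1 s.2)
    obtain ⟨i, hi⟩ := Set.mem_iUnion.1 (h (Set.mem_sUnion.2 ⟨s.1, s.2, hx.mem⟩))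
    refine ⟨i, ?_⟩
    rw [← hx.def]
    exact (hF i).closure_subset_iff.2 (Set.singleton_subset_iff.2 hi)
  choose i hi using key
  have := hS.fintype
  refine ⟨Finset.univ.image i, Set.sUnion_subset fun s hs => (hi ⟨s, hs⟩).trans ?_⟩
  exact Set.subset_biUnion_of_mem (u := F)
    (Finset.mem_coe.2 (Finset.mem_image_of_mem i (Finset.mem_univ _)))

lemma exists_algEquiv_comp_eq {k K Ω : Type} [Field k] [Field K] [Field Ω] [Algebra k K]
    [Normal k K] (τ τ' : K →+* Ω) (h : τ.comp (algebraMap k K) = τ'.comp (algebraMap k K)) :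
    ∃ σ : K ≃ₐ[k] K, τ.comp (σ : K →+* K) = τ' := by
  let _ : Algebra K Ω := τ.toAlgebra
  let _ : Algebra k Ω := (τ.comp (algebraMap k K)).toAlgebra
  have : IsScalarTower k K Ω := IsScalarTower.of_algebraMap_eq fun _ => rfl
  let t : K →ₐ[k] Ω := { τ' with commutes' := fun r => congr($h.symm r) }
  refine ⟨t.restrictNormal' K, RingHom.ext fun x => ?_⟩
  exact t.restrictNormal_commutes K x

section Galois

variable {k K : Type} [Field k] [Field K] [Algebra k K]

/-- The morphism `Spec K ⟶ Spec k`. -/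
noncomputable abbrev specAlg (k K : Type) [Field k] [Field K] [Algebra k K] :
    Spec (CommRingCat.of K) ⟶ Spec (CommRingCat.of k) :=
  Spec.map (CommRingCat.ofHom (algebraMap k K))

lemma specMap_algEquiv_specAlg (σ : K ≃ₐ[k] K) :
    Spec.map (CommRingCat.ofHom (σ : K →+* K)) ≫ specAlg k K = specAlg k K := by
  rw [← Spec.map_comp, ← CommRingCat.ofHom_comp]
  congr 2
  ext x
  exact σ.commutes x

/-- The action of an automorphism of `K` over `k` on a base change to `K`. -/
noncomputable def galAct {X P : Scheme.{0}} {f : X ⟶ Spec (CommRingCat.of k)} {q : P ⟶ X}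
    {p : P ⟶ Spec (CommRingCat.of K)} (H : IsPullback q p f (specAlg k K)) (σ : K ≃ₐ[k] K) :
    P ⟶ P :=
  H.lift q (p ≫ Spec.map (CommRingCat.ofHom (σ : K →+* K))) (by
    rw [Category.assoc, specMap_algEquiv_specAlg, H.w])

variable {X P : Scheme.{0}} {f : X ⟶ Spec (CommRingCat.of k)} {q : P ⟶ X}
    {p : P ⟶ Spec (CommRingCat.of K)} (H : IsPullback q p f (specAlg k K))

@[simp]
lemma galAct_fst (σ : K ≃ₐ[k] K) : galAct H σ ≫ q = q := H.lift_fst _ _ _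

lemma galAct_snd (σ : K ≃ₐ[k] K) :
    galAct H σ ≫ p = p ≫ Spec.map (CommRingCat.ofHom (σ : K →+* K)) := H.lift_snd _ _ _

lemma galAct_snd_assoc (σ : K ≃ₐ[k] K) {T : Scheme.{0}} (h : Spec (CommRingCat.of K) ⟶ T) :
    galAct H σ ≫ p ≫ h = p ≫ Spec.map (CommRingCat.ofHom (σ : K →+* K)) ≫ h := by
  rw [← Category.assoc, galAct_snd, Category.assoc]

lemma galAct_one : galAct H 1 = 𝟙 P := by
  apply H.hom_ext
  · simp
  · rw [galAct_snd]
    exact (congrArg (p ≫ ·) (Spec.map_id _)).trans (by simp)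

lemma galAct_mul (σ τ : K ≃ₐ[k] K) : galAct H (σ * τ) = galAct H σ ≫ galAct H τ := by
  apply H.hom_ext
  · simp
  · rw [Category.assoc, galAct_snd, galAct_snd, galAct_snd_assoc, ← Spec.map_comp]
    rfl

lemma exists_galAct_apply_eq [Normal k K] {x y : P} (hxy : q x = q y) :
    ∃ σ : K ≃ₐ[k] K, galAct H σ x = y := by
  obtain ⟨w, rfl, rfl⟩ := Scheme.Pullback.exists_preimage_pullback x y hxy
  let W := pullback q q
  obtain ⟨a, ha⟩ : ∃ a, a = W.fromSpecResidueField w ≫ pullback.fst q q := ⟨_, rfl⟩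
  obtain ⟨c, hc⟩ : ∃ c, c = W.fromSpecResidueField w ≫ pullback.snd q q := ⟨_, rfl⟩
  have hac : a ≫ q = c ≫ q := by
    simp only [ha, hc, Category.assoc, pullback.condition]
  obtain ⟨τa, hτa⟩ := Spec.map_surjective (a ≫ p)
  obtain ⟨τc, hτc⟩ := Spec.map_surjective (c ≫ p)
  have hcomp : τa.hom.comp (algebraMap k K) = τc.hom.comp (algebraMap k K) := by
    have : Spec.map (CommRingCat.ofHom (τa.hom.comp (algebraMap k K))) =
        Spec.map (CommRingCat.ofHom (τc.hom.comp (algebraMap k K))) := by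
      have e : (a ≫ p) ≫ specAlg k K = (c ≫ p) ≫ specAlg k K := by
        rw [Category.assoc, Category.assoc, ← H.w, reassoc_of% hac]
      rw [← hτa, ← hτc, ← Spec.map_comp, ← Spec.map_comp] at e
      exact e
    exact congr(($(Spec.map_injective this)).hom)
  obtain ⟨σ, hσ⟩ := exists_algEquiv_comp_eq τa.hom τc.hom hcomp
  refine ⟨σ, ?_⟩
  have key : a ≫ galAct H σ = c := by
    apply H.hom_ext
    · rw [Category.assoc, galAct_fst, hac]
    · rw [Category.assoc, galAct_snd, ← hτc, ← Category.assoc, ← hτa, ← Spec.map_comp]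
      congr 1
      ext x
      exact congr($hσ x)
  have hw : ∃ w', W.fromSpecResidueField w w' = w := by
    have : w ∈ Set.range (W.fromSpecResidueField w) := by
      rw [Scheme.range_fromSpecResidueField]; rfl
    exact this
  obtain ⟨w', hw'⟩ := hw
  have := congr($key w')
  simp only [ha, hc, Scheme.Hom.comp_apply, hw'] at this
  exact this

end Galois

section Affinization

lemma le_preimage_top {X Y : Scheme.{0}} (f : X ⟶ Y) : (⊤ : X.Opens) ≤ f ⁻¹ᵁ ⊤ := le_rfl

lemma appLE_top_top {X Y : Scheme.{0}} (f : X ⟶ Y) (h : (⊤ : X.Opens) ≤ f ⁻¹ᵁ ⊤) :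
    f.appLE ⊤ ⊤ h = f.appTop :=
  f.appLE_eq_app

lemma isPushout_appTop_of_isPullback_left {X Y S T : Scheme.{0}} {f : T ⟶ S} {g : Y ⟶ X}
    {iX : X ⟶ S} {iY : Y ⟶ T} (H : IsPullback g iY iX f) [IsAffine S] [IsAffine X]
    [CompactSpace T] [QuasiSeparatedSpace T] [Flat iX] :
    IsPushout iX.appTop f.appTop g.appTop iY.appTop := by
  have := (isIso_pushoutSection_iff H (US := ⊤) (UT := ⊤) (UX := ⊤) (UY := ⊤) (le_preimage_top _)
    (le_preimage_top _)
    (by simp)).1 (isIso_pushoutSection_of_isQuasiSeparated_of_flat_left H _ _ _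
      (isAffineOpen_top S) (isAffineOpen_top X) isCompact_univ
      isQuasiSeparated_univ)
  rwa [appLE_top_top, appLE_top_top, appLE_top_top, appLE_top_top] at this

lemma isPushout_appTop_of_isPullback_right {X Y S T : Scheme.{0}} {f : T ⟶ S} {g : Y ⟶ X}
    {iX : X ⟶ S} {iY : Y ⟶ T} (H : IsPullback g iY iX f) [IsAffine S] [IsAffine T]
    [CompactSpace X] [QuasiSeparatedSpace X] [Flat f] :
    IsPushout iX.appTop f.appTop g.appTop iY.appTop := by
  have := (isIso_pushoutSection_iff H (US := ⊤) (UT := ⊤) (UX := ⊤) (UY := ⊤) (le_preimage_top _)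
    (le_preimage_top _)
    (by simp)).1 (isIso_pushoutSection_of_isQuasiSeparated_of_flat_right H _ _ _
      (isAffineOpen_top S) (isAffineOpen_top T) isCompact_univ
      isQuasiSeparated_univ)
  rwa [appLE_top_top, appLE_top_top, appLE_top_top, appLE_top_top] at this

lemma isIso_appTop_of_isPullback {X Y S T : Scheme.{0}} {f : T ⟶ S} {g : Y ⟶ X}
    {iX : X ⟶ S} {iY : Y ⟶ T} (H : IsPullback g iY iX f) [IsAffine S] [IsAffine X]
    [CompactSpace T] [QuasiSeparatedSpace T] [Flat iX] [IsIso f.appTop] : IsIso g.appTop :=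
  (isPushout_appTop_of_isPullback_left H).isIso_inl_of_isIso

/-- The comparison of an affine scheme `V` with the affinization of `U` induced by a common
cover `W` having the same global sections as `V`. -/
noncomputable def affinizationMap {U V W : Scheme.{0}} (q : W ⟶ U) (π : W ⟶ V)
    [IsIso π.appTop] : V ⟶ Spec Γ(U, ⊤) :=
  V.toSpecΓ ≫ Spec.map (q.appTop ≫ inv π.appTop)

lemma comp_affinizationMap {U V W : Scheme.{0}} (q : W ⟶ U) (π : W ⟶ V) [IsIso π.appTop] :
    π ≫ affinizationMap q π = q ≫ U.toSpecΓ := by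
  rw [affinizationMap, Scheme.toSpecΓ_naturality, ← Category.assoc, Scheme.toSpecΓ_naturality,
    Category.assoc, ← Spec.map_comp]
  simp

lemma affinizationMap_naturality {U V W U' V' W' : Scheme.{0}} (q : W ⟶ U) (π : W ⟶ V)
    (q' : W' ⟶ U') (π' : W' ⟶ V') [IsIso π.appTop] [IsIso π'.appTop] (u : U ⟶ U') (v : V ⟶ V')
    (w : W ⟶ W') (hu : q ≫ u = w ≫ q') (hv : π ≫ v = w ≫ π') :
    v ≫ affinizationMap q' π' = affinizationMap q π ≫ Spec.map u.appTop := by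
  rw [affinizationMap, affinizationMap, Scheme.toSpecΓ_naturality_assoc, Category.assoc,
    ← Spec.map_comp, ← Spec.map_comp]
  congr 2
  rw [← cancel_mono π.appTop]
  simp only [Category.assoc, IsIso.inv_hom_id, Category.comp_id]
  rw [← Scheme.Hom.comp_appTop, ← Scheme.Hom.comp_appTop, hu, hv, Scheme.Hom.comp_appTop,
    Scheme.Hom.comp_appTop]
  simp

lemma isPullback_affinizationMap {U V W B B' : Scheme.{0}} {q : W ⟶ U} {π : W ⟶ V} {p : W ⟶ B'}
    {f : U ⟶ B} {b : B' ⟶ B} (H : IsPullback q p f b) [IsAffine B] [IsAffine B'] [IsAffine V]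
    [CompactSpace U] [QuasiSeparatedSpace U] [Flat b] [IsIso π.appTop] {z : V ⟶ B'}
    (hp : π ≫ z = p) :
    IsPullback (affinizationMap q π) z (Spec.map f.appTop ≫ inv B.toSpecΓ) b := by
  have h := (isPullback_SpecMap_of_isPushout _ _ _ _
    (isPushout_appTop_of_isPullback_right H).flip).flip
  refine h.of_iso (asIso (V.toSpecΓ ≫ Spec.map (inv π.appTop))).symm (Iso.refl _)
    (asIso B'.toSpecΓ).symm (asIso B.toSpecΓ).symm ?_ ?_ ?_ ?_
  · simp [affinizationMap]
  · simp only [Iso.symm_hom, asIso_inv]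
    rw [IsIso.comp_inv_eq, Category.assoc, IsIso.eq_inv_comp, Scheme.toSpecΓ_naturality,
      Category.assoc, ← Spec.map_comp, ← hp, Scheme.Hom.comp_appTop]
    simp
  · simp
  · simp only [Iso.symm_hom, asIso_inv]
    rw [IsIso.comp_inv_eq, Category.assoc, IsIso.eq_inv_comp, Scheme.toSpecΓ_naturality]

end Affinization

lemma exists_descent_of_openCover {X P Z Q B B' : Scheme.{0}} {f : X ⟶ B} {q : P ⟶ X} {p : P ⟶ B'}
    {b : B' ⟶ B} (H : IsPullback q p f b) [IsAffine B] [IsAffine B'] [IsNoetherian X]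
    [Surjective b] [Flat b] [QuasiCompact b] {π : P ⟶ Z} {ρ : P ⟶ Q} {z : Z ⟶ B'} {c : Q ⟶ B'}
    (hπ : IsPullback π ρ z c) (hp : π ≫ z = p) [Flat z] [CompactSpace Q] [QuasiSeparatedSpace Q]
    [IsIso c.appTop]
    (hinf : ∀ V V' : Z.Opens, IsAffineOpen V → IsAffineOpen V' → IsAffineOpen (V ⊓ V'))
    (hcov : ∀ x : Z, ∃ (U : X.Opens) (V : Z.Opens), q ⁻¹ᵁ U = π ⁻¹ᵁ V ∧ IsAffineOpen V ∧ x ∈ V)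
    (hqs : Function.Surjective q) :
    ∃ (Y : Scheme.{0}) (g : Y ⟶ B) (β : Z ⟶ Y) (r : X ⟶ Y), IsPullback β z g b ∧
      r ≫ g = f ∧ q ≫ r = π ≫ β := by
  let J := {j : X.Opens × Z.Opens // q ⁻¹ᵁ j.1 = π ⁻¹ᵁ j.2 ∧ IsAffineOpen j.2}
  let U (j : J) : X.Opens := j.1.1
  let V (j : J) : Z.Opens := j.1.2
  let W (j : J) : P.Opens := π ⁻¹ᵁ V j
  have hWU (j : J) : W j = q ⁻¹ᵁ U j := j.2.1.symm
  have hVaff (j : J) : IsAffine (V j) := j.2.2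
  have hU : Monotone U := fun i j h => h.1
  have hV : Monotone V := fun i j h => h.2
  have hVcov (x : Z) : ∃ j, x ∈ V j := by
    obtain ⟨U, V, h1, h2, h3⟩ := hcov x
    exact ⟨⟨⟨U, V⟩, h1, h2⟩, h3⟩
  let infJ (i j : J) : J := ⟨⟨U i ⊓ U j, V i ⊓ V j⟩, by
    change q ⁻¹ᵁ U i ⊓ q ⁻¹ᵁ U j = π ⁻¹ᵁ V i ⊓ π ⁻¹ᵁ V j
    rw [← hWU, ← hWU], hinf _ _ i.2.2 j.2.2⟩
  have hdir (i j : J) (x : Z) (hi : x ∈ V i) (hj : x ∈ V j) : ∃ k, k ≤ i ∧ k ≤ j ∧ x ∈ V k :=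
    ⟨infJ i j, ⟨inf_le_left, inf_le_left⟩, ⟨inf_le_right, inf_le_right⟩, ⟨hi, hj⟩⟩
  have hUV (x : P) (j : J) : q x ∈ U j ↔ π x ∈ V j := by
    change x ∈ q ⁻¹ᵁ U j ↔ x ∈ π ⁻¹ᵁ V j
    rw [← hWU]
  have hUcov (x : X) : ∃ j, x ∈ U j := by
    obtain ⟨y, rfl⟩ := hqs x
    obtain ⟨j, hj⟩ := hVcov (π y)
    exact ⟨j, (hUV y j).2 hj⟩
  let πj (j : J) : (W j).toScheme ⟶ V j := π.resLE (V j) (W j) le_rfl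
  let qj (j : J) : (W j).toScheme ⟶ U j := q.resLE (U j) (W j) (hWU j).le
  have hqj (j : J) : IsPullback (qj j) ((W j).ι ≫ p) ((U j).ι ≫ f) b := by
    refine IsPullback.paste_vert (v₁₂ := (U j).ι) (v₁₁ := (W j).ι) (h₂₁ := q) ?_ H
    refine IsOpenImmersion.isPullback _ _ _ _ (Scheme.Hom.resLE_comp_ι ..).symm ?_
    simp [hWU]
  have hπj (j : J) : IsPullback (πj j) ((W j).ι ≫ ρ) ((V j).ι ≫ z) c := by
    refine IsPullback.paste_vert (v₁₂ := (V j).ι) (v₁₁ := (W j).ι) (h₂₁ := π) ?_ hπ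
    refine IsOpenImmersion.isPullback _ _ _ _ (Scheme.Hom.resLE_comp_ι ..).symm ?_
    simp [W]
  have hiso (j : J) : IsIso (πj j).appTop := isIso_appTop_of_isPullback (hπj j)
  let F : J ⥤ Scheme.{0} :=
    { obj := fun j => Spec Γ(U j, ⊤)
      map := fun {i j} h => Spec.map (X.homOfLE (hU (leOfHom h))).appTop
      map_id := fun i => by simp
      map_comp := fun {i j l} h h' => by
        rw [← Spec.map_comp, ← Scheme.Hom.comp_appTop, Scheme.homOfLE_homOfLE] }
  obtain ⟨Y, gY, βY, ι, hpb, hιg, hFι, hβ⟩ := exists_glue_of_isPullback b z V hV hVcov hdir F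
    (fun j => Spec.map ((U j).ι ≫ f).appTop ≫ inv B.toSpecΓ)
    (fun {i j} h => by
      change Spec.map _ ≫ _ = _
      rw [← Category.assoc, ← Spec.map_comp, ← Scheme.Hom.comp_appTop, Scheme.homOfLE_ι_assoc])
    (fun j => affinizationMap (qj j) (πj j))
    (fun {i j} h => by
      refine affinizationMap_naturality _ _ _ _ _ _
        (P.homOfLE (π.preimage_mono (hV (leOfHom h)))) ?_ ?_
      · simp [qj, Scheme.Hom.map_resLE, Scheme.Hom.resLE_map]
      · simp [πj, Scheme.Hom.map_resLE, Scheme.Hom.resLE_map])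
    (fun j => by
      have : CompactSpace (U j) :=
        isCompact_iff_compactSpace.1 (TopologicalSpace.NoetherianSpace.isCompact _)
      refine isPullback_affinizationMap (hqj j) ?_
      simp [πj, ← hp])
  obtain ⟨r, hr⟩ := exists_glueMorphisms U hUcov (fun j => (U j).toScheme.toSpecΓ ≫ ι j)
    (fun i j x hi hj => by
      refine ⟨infJ i j, inf_le_left, inf_le_right, ⟨hi, hj⟩, ?_⟩
      rw [Scheme.toSpecΓ_naturality_assoc, Scheme.toSpecΓ_naturality_assoc]
      have h1 : infJ i j ≤ i := ⟨inf_le_left, inf_le_left⟩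
      have h2 : infJ i j ≤ j := ⟨inf_le_right, inf_le_right⟩
      exact congrArg _ ((hFι (homOfLE h1)).trans (hFι (homOfLE h2)).symm))
  refine ⟨Y, gY, βY, r, hpb, ?_, ?_⟩
  · refine Scheme.hom_ext_of_openCover_opens U hUcov fun j => ?_
    rw [← Category.assoc, hr, Category.assoc, hιg, ← Category.assoc, ← Scheme.toSpecΓ_naturality]
    simp
  · refine Scheme.hom_ext_of_openCover_opens W (fun x => ?_) fun j => ?_
    · exact hVcov (π x)
    · have e1 : (W j).ι ≫ q = qj j ≫ (U j).ι := (Scheme.Hom.resLE_comp_ι ..).symm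
      have e2 : (W j).ι ≫ π = πj j ≫ (V j).ι := (Scheme.Hom.resLE_comp_ι ..).symm
      rw [reassoc_of% e1, reassoc_of% e2, hr, hβ, ← Category.assoc,
        ← comp_affinizationMap (qj j) (πj j),
        Category.assoc]

lemma exists_isAffineOpen_forall_mem_iff {Z : Scheme.{0}}
    (hinf : ∀ V V' : Z.Opens, IsAffineOpen V → IsAffineOpen V' → IsAffineOpen (V ⊓ V'))
    {ι : Type*} (V : ι → Z.Opens) (hV : ∀ i, IsAffineOpen (V i)) (S : Finset ι)
    (hS : S.Nonempty) : ∃ V' : Z.Opens, IsAffineOpen V' ∧ ∀ x, x ∈ V' ↔ ∀ i ∈ S, x ∈ V i := by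
  induction hS using Finset.Nonempty.cons_induction with
  | singleton i => exact ⟨V i, hV i, by simp⟩
  | cons i S hi hS ih =>
    obtain ⟨V', h1, h2⟩ := ih
    refine ⟨V i ⊓ V', hinf _ _ (hV i) h1, fun x => ?_⟩
    rw [Finset.forall_mem_cons, ← h2]
    rfl

section Galois

variable {k K : Type} [Field k] [Field K] [Algebra k K]

instance surjective_specAlg : Surjective (specAlg k K) :=
  ⟨fun _ => ⟨(⊥ : PrimeSpectrum K), Subsingleton.elim (α := PrimeSpectrum k) _ _⟩⟩

instance isIntegralHom_specAlg [Algebra.IsAlgebraic k K] : IsIntegralHom (specAlg k K) := by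
  rw [specAlg, IsIntegralHom.SpecMap_iff]
  exact algebraMap_isIntegral_iff.2 inferInstance

variable {X P : Scheme.{0}} {f : X ⟶ Spec (CommRingCat.of k)} {q : P ⟶ X}
    {p : P ⟶ Spec (CommRingCat.of K)} (H : IsPullback q p f (specAlg k K))

include H

lemma surjective_of_isPullback_specAlg : Surjective q :=
  MorphismProperty.of_isPullback H.flip inferInstance

lemma isClosedMap_of_isPullback_specAlg [Algebra.IsAlgebraic k K] : IsClosedMap q := by
  have : IsIntegralHom q := MorphismProperty.of_isPullback H.flip inferInstance
  exact q.isClosedMap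

lemma galAct_one_apply (x : P) : galAct H 1 x = x := by
  rw [galAct_one]; rfl

lemma apply_galAct_apply (σ : K ≃ₐ[k] K) (x : P) : q (galAct H σ x) = q x := by
  rw [← Scheme.Hom.comp_apply, galAct_fst]

lemma exists_finset_saturation [Normal k K] [TopologicalSpace.NoetherianSpace P] {E : Set P}
    (hE : IsClosed E) : ∃ T : Finset (K ≃ₐ[k] K), T.Nonempty ∧
      ∀ x, q x ∈ q '' E ↔ ∃ σ ∈ T, galAct H σ x ∈ E := by
  classical
  have hcl : IsClosed (q ⁻¹' (q '' E)) :=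
    (isClosedMap_of_isPullback_specAlg H _ hE).preimage q.continuous
  obtain ⟨T, hT⟩ := exists_finset_closed_subcover hcl (fun σ => galAct H σ ⁻¹' E)
    (fun σ => hE.preimage (galAct H σ).continuous) (by
      rintro x ⟨e, he, hx⟩
      obtain ⟨σ, hσ⟩ := exists_galAct_apply_eq H hx.symm
      exact Set.mem_iUnion.2 ⟨σ, by rw [Set.mem_preimage, hσ]; exact he⟩)
  refine ⟨insert 1 T, Finset.insert_nonempty _ _, fun x => ⟨fun hx => ?_, ?_⟩⟩
  · obtain ⟨σ, hσ, h⟩ := Set.mem_iUnion₂.1 (hT hx)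
    exact ⟨σ, Finset.mem_insert_of_mem hσ, h⟩
  · rintro ⟨σ, -, h⟩
    exact ⟨_, h, apply_galAct_apply H σ x⟩

lemma exists_invariant_affineOpen [Normal k K] [TopologicalSpace.NoetherianSpace P]
    {Z : Scheme.{0}} [JacobsonSpace Z] {π : P ⟶ Z} (hπ : Function.Surjective π)
    (ψ : (K ≃ₐ[k] K) → (Z ⟶ Z)) [∀ σ, IsIso (ψ σ)] (hψ : ∀ σ, galAct H σ ≫ π = π ≫ ψ σ)
    (hinf : ∀ V V' : Z.Opens, IsAffineOpen V → IsAffineOpen V' → IsAffineOpen (V ⊓ V'))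
    (hAF : ∀ S : Finset Z, ∃ V : Z.Opens, IsAffineOpen V ∧ ∀ x ∈ S, x ∈ V) (x : Z) :
    ∃ (U : X.Opens) (V : Z.Opens), q ⁻¹ᵁ U = π ⁻¹ᵁ V ∧ IsAffineOpen V ∧ x ∈ V := by
  classical
  have hψ' (σ : K ≃ₐ[k] K) (y : P) : π (galAct H σ y) = ψ σ (π y) := by
    rw [← Scheme.Hom.comp_apply, hψ, Scheme.Hom.comp_apply]
  have hmul (σ τ : K ≃ₐ[k] K) (w : Z) : ψ (σ * τ) w = ψ τ (ψ σ w) := by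
    obtain ⟨y, rfl⟩ := hπ w
    rw [← hψ', ← hψ', ← hψ', galAct_mul, Scheme.Hom.comp_apply]
  have hone (w : Z) : ψ 1 w = w := by
    obtain ⟨y, rfl⟩ := hπ w
    rw [← hψ', galAct_one_apply]
  have key (z0 : Z) (hz0 : IsClosed {z0}) :
      ∃ (U : X.Opens) (V : Z.Opens), q ⁻¹ᵁ U = π ⁻¹ᵁ V ∧ IsAffineOpen V ∧ z0 ∈ V := by
    obtain ⟨T, -, hT⟩ := exists_finset_saturation H (hz0.preimage π.continuous)
    have horb (τ : K ≃ₐ[k] K) : ψ τ z0 ∈ T.image fun σ => ψ σ⁻¹ z0 := by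
      obtain ⟨y, hy⟩ := hπ (ψ τ z0)
      obtain ⟨σ, hσ, h⟩ := (hT y).1 ⟨galAct H τ⁻¹ y, by
        change π (galAct H τ⁻¹ y) = z0
        rw [hψ', hy, ← hmul, mul_inv_cancel, hone], apply_galAct_apply H _ _⟩
      refine Finset.mem_image.2 ⟨σ, hσ, ?_⟩
      change π (galAct H σ y) = z0 at h
      rw [← hy, ← h, hψ', ← hmul, mul_inv_cancel, hone]
    obtain ⟨V0, hV0, hmem⟩ := hAF (T.image fun σ => ψ σ⁻¹ z0)
    have hD : IsClosed ((π ⁻¹ᵁ V0 : P.Opens) : Set P)ᶜ := (π ⁻¹ᵁ V0).isOpen.isClosed_compl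
    obtain ⟨T', hT'0, hT'⟩ := exists_finset_saturation H hD
    obtain ⟨V, hV, hVmem⟩ := exists_isAffineOpen_forall_mem_iff hinf (fun σ => ψ σ ⁻¹ᵁ V0)
      (fun σ => hV0.preimage_of_isIso (ψ σ)) T' hT'0
    refine ⟨⟨_, (isClosedMap_of_isPullback_specAlg H _ hD).isOpen_compl⟩, V, ?_, hV,
      (hVmem z0).2 fun σ _ => hmem _ (horb σ)⟩
    ext y
    change ¬ (q y ∈ _) ↔ π y ∈ V
    rw [hT', hVmem]
    simp only [not_exists, not_and]
    refine forall₂_congr fun σ hσ => ?_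
    change ¬ ¬ (π (galAct H σ y) ∈ V0) ↔ ψ σ (π y) ∈ V0
    rw [not_not, hψ']
  let C : Set Z := ⋃ (V : {V : Z.Opens // ∃ U : X.Opens, q ⁻¹ᵁ U = π ⁻¹ᵁ V ∧ IsAffineOpen V}), V.1
  have hC : IsOpen C := isOpen_iUnion fun V => V.1.isOpen
  by_contra hx
  have hxC : x ∉ C := by
    rintro hx'
    obtain ⟨⟨V, U, h1, h2⟩, h3⟩ := Set.mem_iUnion.1 hx'
    exact hx ⟨U, V, h1, h2, h3⟩
  obtain ⟨w, hw, hw'⟩ :=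
    nonempty_inter_closedPoints (Z := Cᶜ) ⟨x, hxC⟩ hC.isClosed_compl.isLocallyClosed
  obtain ⟨U, V, h1, h2, h3⟩ := key w hw'
  exact hw (Set.mem_iUnion.2 ⟨⟨V, U, h1, h2⟩, h3⟩)

end Galois

section AlgClosed

variable {K : Type} [Field K] [IsAlgClosed K]

lemma isIso_appTop_of_isProper {Q : Scheme.{0}} [IsIntegral Q] (c : Q ⟶ Spec (CommRingCat.of K))
    [IsProper c] : IsIso c.appTop := by
  have h1 : ((Scheme.ΓSpecIso (CommRingCat.of K)).inv ≫ c.appTop).hom.IsIntegral := by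
    apply RingHom.isIntegral_respectsIso.2
      (e := (Scheme.ΓSpecIso (CommRingCat.of K)).symm.commRingCatIsoToRingEquiv)
    exact isIntegral_appTop_of_universallyClosed c
  have h2 := IsAlgClosed.ringHom_bijective_of_isIntegral _ h1
  have h3 : IsIso ((Scheme.ΓSpecIso (CommRingCat.of K)).inv ≫ c.appTop) := by
    rw [ConcreteCategory.isIso_iff_bijective]
    exact h2
  exact (isIso_comp_left_iff (Scheme.ΓSpecIso (CommRingCat.of K)).inv c.appTop).1 h3

lemma exists_point_of_nonempty {Q : Scheme.{0}} [Nonempty Q] (c : Q ⟶ Spec (CommRingCat.of K))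
    [LocallyOfFiniteType c] : ∃ t : Spec (CommRingCat.of K) ⟶ Q, t ≫ c = 𝟙 _ := by
  have : JacobsonSpace Q := LocallyOfFiniteType.jacobsonSpace c
  obtain ⟨x, -, hx⟩ := nonempty_inter_closedPoints (X := Q) Set.univ_nonempty
    isClosed_univ.isLocallyClosed
  exact ⟨pointOfClosedPoint c x hx, pointOfClosedPoint_comp c x hx⟩

lemma hom_ext_of_points {P Z : Scheme.{0}} [IsReduced P] (p : P ⟶ Spec (CommRingCat.of K))
    [LocallyOfFiniteType p] (z : Z ⟶ Spec (CommRingCat.of K)) [IsSeparated z]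
    [LocallyOfFiniteType z] {g h : P ⟶ Z} [LocallyOfFiniteType (g ≫ z)] (hz : g ≫ z = h ≫ z)
    (H : ∀ a : Spec (CommRingCat.of K) ⟶ P, a ≫ p = 𝟙 _ → a ≫ g = a ≫ h) : g = h := by
  refine ext_of_apply_eq z Set.univ isClosed_univ.isLocallyClosed dense_univ (fun x _ hx => ?_) hz
  have := congr($(H (pointOfClosedPoint p x hx) (pointOfClosedPoint_comp p x hx))
    (IsLocalRing.closedPoint K))
  have e (l : P ⟶ Z) :
      (pointOfClosedPoint p x hx ≫ l) (IsLocalRing.closedPoint K) = l x :=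
    (Scheme.Hom.comp_apply _ _ _).trans (congrArg l (pointOfClosedPoint_apply p x hx _))
  exact (e g).symm.trans (this.trans (e h))

variable {k : Type} [Field k] [Algebra k K] [Normal k K]

theorem exists_descent {X P Z Q : Scheme.{0}} {f : X ⟶ Spec (CommRingCat.of k)} {q : P ⟶ X}
    {p : P ⟶ Spec (CommRingCat.of K)} (H : IsPullback q p f (specAlg k K))
    [LocallyOfFiniteType f] [QuasiCompact f] [IsReduced P] [IsIntegral Q] {π : P ⟶ Z} {ρ : P ⟶ Q}
    {z : Z ⟶ Spec (CommRingCat.of K)} {c : Q ⟶ Spec (CommRingCat.of K)} [IsProper z] [IsProper c]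
    (hπ : IsPullback π ρ z c) (hp : π ≫ z = p)
    (hAF : ∀ S : Finset Z, ∃ V : Z.Opens, IsAffineOpen V ∧ ∀ x ∈ S, x ∈ V)
    (hH : ∀ (σ : K ≃ₐ[k] K) (a b : Spec (CommRingCat.of K) ⟶ P), a ≫ p = 𝟙 _ → b ≫ p = 𝟙 _ →
      a ≫ π = b ≫ π → a ≫ galAct H σ ≫ π = b ≫ galAct H σ ≫ π) :
    ∃ (Y : Scheme.{0}) (g : Y ⟶ Spec (CommRingCat.of k)) (β : Z ⟶ Y) (r : X ⟶ Y),
      IsPullback β z g (specAlg k K) ∧ r ≫ g = f ∧ q ≫ r = π ≫ β := by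
  have hpl : LocallyOfFiniteType p := MorphismProperty.of_isPullback H ‹_›
  have hpq : QuasiCompact p := MorphismProperty.of_isPullback H ‹_›
  have : IsLocallyNoetherian X := LocallyOfFiniteType.isLocallyNoetherian f
  have : CompactSpace X := (quasiCompact_iff_compactSpace f).1 ‹_›
  have : IsNoetherian X := {}
  have : IsLocallyNoetherian P := LocallyOfFiniteType.isLocallyNoetherian p
  have : CompactSpace P := (quasiCompact_iff_compactSpace p).1 ‹_›
  have : IsNoetherian P := {}
  have : JacobsonSpace Z := LocallyOfFiniteType.jacobsonSpace z
  have : CompactSpace Q := (quasiCompact_iff_compactSpace c).1 inferInstance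
  have : QuasiSeparatedSpace Q := (quasiSeparated_iff_quasiSeparatedSpace c).1 inferInstance
  have : IsIso c.appTop := isIso_appTop_of_isProper c
  obtain ⟨t, ht⟩ := exists_point_of_nonempty c
  obtain ⟨s, hs, -⟩ : ∃ s : Z ⟶ P, s ≫ π = 𝟙 Z ∧ s ≫ ρ = z ≫ t :=
    ⟨hπ.lift (𝟙 Z) (z ≫ t) (by simp [ht]), hπ.lift_fst .., hπ.lift_snd ..⟩
  have hsp : s ≫ p = z := by rw [← hp, reassoc_of% hs]
  let ψ (σ : K ≃ₐ[k] K) : Z ⟶ Z := s ≫ galAct H σ ≫ π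
  have hψ (σ : K ≃ₐ[k] K) : galAct H σ ≫ π = π ≫ ψ σ := by
    have hiso : IsIso (Spec.map (CommRingCat.ofHom (σ : K →+* K))) := by
      have : IsIso (CommRingCat.ofHom (σ : K →+* K)) := by
        rw [ConcreteCategory.isIso_iff_bijective]
        exact σ.bijective
      infer_instance
    have e1 : (galAct H σ ≫ π) ≫ z = p ≫ Spec.map (CommRingCat.ofHom (σ : K →+* K)) := by
      rw [Category.assoc, hp, galAct_snd]
    have : LocallyOfFiniteType ((galAct H σ ≫ π) ≫ z) := by
      rw [e1]; infer_instance
    refine hom_ext_of_points p z ?_ fun a ha => ?_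
    · rw [e1]
      simp only [ψ, Category.assoc]
      rw [hp, galAct_snd, reassoc_of% hsp, reassoc_of% hp]
    · have := hH σ a (a ≫ π ≫ s) ha (by simp [hsp, hp, ha]) (by simp [hs])
      simpa [ψ] using this
  clear_value ψ
  have hepi : Epi π := by
    have : IsSplitEpi π := ⟨⟨⟨s, hs⟩⟩⟩
    infer_instance
  have hcomp (σ τ : K ≃ₐ[k] K) : ψ σ ≫ ψ τ = ψ (σ * τ) := by
    rw [← cancel_epi π, ← hψ, galAct_mul, Category.assoc, hψ τ, reassoc_of% (hψ σ)]
  have hone : ψ 1 = 𝟙 Z := by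
    rw [← cancel_epi π, ← hψ, galAct_one, Category.id_comp, Category.comp_id]
  have hiso (σ : K ≃ₐ[k] K) : IsIso (ψ σ) :=
    ⟨ψ σ⁻¹, by rw [hcomp, mul_inv_cancel, hone], by rw [hcomp, inv_mul_cancel, hone]⟩
  have hsep : Z.IsSeparated := by
    rw [Scheme.isSeparated_iff, ← terminal.comp_from z, IsSeparated.comp_iff]
    infer_instance
  have hinf (V V' : Z.Opens) (hV : IsAffineOpen V) (hV' : IsAffineOpen V') :
      IsAffineOpen (V ⊓ V') := hV.inf hV'
  have hsurj : Function.Surjective π := fun x => ⟨s x, by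
    rw [← Scheme.Hom.comp_apply, hs]; rfl⟩
  exact exists_descent_of_openCover H hπ hp hinf
    (exists_invariant_affineOpen H hsurj ψ hψ hinf hAF)
    (surjective_of_isPullback_specAlg H).surj

end AlgClosed

lemma irreducibleSpace_of_cover {X ι : Type*} [TopologicalSpace X] {U : ι → Set X} {x : X}
    (hU : ∀ i, IsOpen (U i)) (hi : ∀ i, IsPreirreducible (U i)) (hx : ∀ i, x ∈ U i)
    (hc : ∀ y, ∃ i, y ∈ U i) : IrreducibleSpace X := by
  have : PreirreducibleSpace X := by
    refine ⟨fun V W hV hW ⟨v, _, hv⟩ ⟨w, _, hw⟩ => ?_⟩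
    obtain ⟨i, hvi⟩ := hc v
    obtain ⟨j, hwj⟩ := hc w
    obtain ⟨y, hy, hyV, hyj⟩ := hi i V (U j) hV (hU j) ⟨v, hvi, hv⟩ ⟨x, hx i, hx j⟩
    obtain ⟨t, -, htV, htW⟩ := hi j V W hV hW ⟨y, hyj, hyV⟩ ⟨w, hwj, hw⟩
    exact ⟨t, trivial, htV, htW⟩
  exact ⟨⟨x⟩⟩

namespace ProjSpace

variable {K : Type} [Field K] {b : ℕ} {L : Type} [Field L]

lemma isDomain_of_isPushout_chartC (θ : K →+* L) (j : Fin (b + 1)) {D : CommRingCat.{0}}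
    {u : CommRingCat.of (Chart K b j) ⟶ D} {v : CommRingCat.of L ⟶ D}
    (H : IsPushout (CommRingCat.ofHom (chartC j)) (CommRingCat.ofHom θ) u v) : IsDomain D := by
  have hj : IsUnit (Function.update (X : Fin (b + 1) → MvPolynomial (Fin (b + 1)) L) j 1 j) := by
    simp
  let φ := H.desc (W := CommRingCat.of (MvPolynomial (Fin (b + 1)) L))
    (CommRingCat.ofHom (chartEval (C.comp θ) (Function.update X j 1) j hj))
    (CommRingCat.ofHom C) (by
      ext c
      simp [chartEval_chartC])
  let ψ : CommRingCat.of (MvPolynomial (Fin (b + 1)) L) ⟶ D :=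
    CommRingCat.ofHom (eval₂Hom v.hom fun i => u.hom (chartX j i))
  have hid : φ ≫ ψ = 𝟙 D := by
    refine H.hom_ext ?_ ?_
    · rw [Category.comp_id, ← Category.assoc, H.inl_desc]
      ext1
      refine chart_ringHom_ext ?_ fun i => ?_
      · ext c
        have := congr($(H.w).hom c)
        simpa [chartEval_chartC, ψ] using this.symm
      · have := chartEval_chartX (C.comp θ) (Function.update X j 1) j hj i
        rw [Function.update_self, mul_one] at this
        simp only [CommRingCat.hom_comp, CommRingCat.hom_ofHom, RingHom.comp_apply, ψ, this]
        by_cases h : i = j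
        · subst h
          simp [chartX_self]
        · simp [Function.update_of_ne h]
    · rw [Category.comp_id, ← Category.assoc, H.inr_desc]
      ext c
      simp [ψ]
  have hinj : Function.Injective φ.hom := by
    intro x y h
    have h1 := congr($(hid).hom x)
    have h2 := congr($(hid).hom y)
    simp only [CommRingCat.hom_comp, RingHom.comp_apply, CommRingCat.hom_id,
      RingHom.id_apply] at h1 h2
    rw [← h1, ← h2, h]
  exact hinj.isDomain φ.hom

lemma isIntegral_of_isPullback (θ : K →+* L) {Z : Scheme.{0}} {p : Z ⟶ ProjSpace K b}
    {q : Z ⟶ Spec (CommRingCat.of L)}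
    (H : IsPullback p q (structMor K b) (Spec.map (CommRingCat.ofHom θ))) : IsIntegral Z := by
  have key (j : Fin (b + 1)) : ∃ (D : CommRingCat.{0}) (e : Spec D ⟶ Z)
      (a : Spec D ⟶ Spec (CommRingCat.of (Chart K b j))), IsDomain D ∧
      IsPullback e a p (chartι K j) := by
    let u := pushout.inl (CommRingCat.ofHom (chartC (K := K) j)) (CommRingCat.ofHom θ)
    let v := pushout.inr (CommRingCat.ofHom (chartC (K := K) j)) (CommRingCat.ofHom θ)
    have hpo : IsPushout (CommRingCat.ofHom (chartC j)) (CommRingCat.ofHom θ) u v :=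
      .of_hasPushout _ _
    have hpb := isPullback_SpecMap_of_isPushout _ _ _ _ hpo
    rw [← chartι_structMor] at hpb
    exact ⟨_, _, _, isDomain_of_isPushout_chartC θ j hpo, (IsPullback.of_bot' hpb H).flip⟩
  choose D e a hD he using key
  have hopen (j) : IsOpenImmersion (e j) :=
    MorphismProperty.of_isPullback (P := @IsOpenImmersion) (he j).flip inferInstance
  have hD' (j) : IsIntegral (Spec (D j)) := inferInstance
  have hcov (x : Z) : ∃ j y, e j y = x := by
    obtain ⟨j, y, hy⟩ := exists_mem_range_chartι (p x)
    obtain ⟨w, hw, -⟩ := exists_of_isPullback (he j) x y hy.symm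
    exact ⟨j, w, hw⟩
  have hred : IsReduced Z := by
    have hr (j) : AlgebraicGeometry.IsReduced (Spec (D j)) := inferInstance
    let 𝒰 : Z.OpenCover := Scheme.Cover.mkOfCovers _ _ e hcov hopen
    have (i : 𝒰.I₀) : IsReduced (𝒰.X i) := hr i
    exact IsReduced.of_openCover Z 𝒰
  have hone : IsUnit ((fun _ => 1 : Fin (b + 1) → L) 0) := isUnit_one
  let t : Spec (CommRingCat.of L) ⟶ Z := H.lift (pt θ (fun _ => 1) 0 hone) (𝟙 _) (by
    rw [pt_structMor, Category.id_comp])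
  let x₀ : Spec (CommRingCat.of L) := (⊥ : PrimeSpectrum L)
  have ht : t ≫ p = pt θ (fun _ => 1) 0 hone := H.lift_fst _ _ _
  have hirr : IrreducibleSpace Z := by
    refine irreducibleSpace_of_cover (U := fun j => Set.range (e j)) (x := t x₀)
      (fun j => (e j).isOpenEmbedding.isOpen_range) (fun j => ?_) (fun j => ?_) hcov
    · rw [← Set.image_univ]
      exact (IrreducibleSpace.isIrreducible_univ _).isPreirreducible.image _
        (e j).continuous.continuousOn
    · have h1 : t ≫ p = Spec.map (CommRingCat.ofHom (chartEval θ (fun _ => 1) j isUnit_one)) ≫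
          chartι K j := ht.trans (pt_eq_of_isUnit θ _ 0 j hone isUnit_one)
      obtain ⟨w, hw, -⟩ := exists_of_isPullback (he j) (t x₀) _
        ((Scheme.Hom.comp_apply t p x₀).symm.trans
        (congr($(h1) x₀).trans (Scheme.Hom.comp_apply _ _ x₀)))
      exact ⟨w, hw⟩
  exact isIntegral_of_irreducibleSpace_of_isReduced Z

instance : GeometricallyIntegral (structMor K b) := by
  refine ⟨geometrically_iff_of_commRing.mpr fun L _ _ Z p q H => ?_⟩
  exact isIntegral_of_isPullback _ H

end ProjSpace

namespace ProjSpace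

variable {K : Type} [Field K] {b : ℕ}

instance : IsProper (structMor K b) := by
  have : IsScalarTower K (homogeneousSubmodule (Fin (b + 1)) K 0)
      (MvPolynomial (Fin (b + 1)) K) := ⟨fun x y z => by
        change (x • (y : MvPolynomial (Fin (b + 1)) K)) * z = x • ((y : MvPolynomial _ K) * z)
        exact smul_mul_assoc x _ z⟩
  have : Algebra.FiniteType (homogeneousSubmodule (Fin (b + 1)) K 0)
      (MvPolynomial (Fin (b + 1)) K) :=
    Algebra.FiniteType.of_restrictScalars_finiteType K _ _
  have hbij : Function.Bijective (algebraMap K (homogeneousSubmodule (Fin (b + 1)) K 0)) := by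
    refine ⟨fun x y h => C_injective (Fin (b + 1)) K congr(($h).1), fun ⟨x, hx⟩ => ?_⟩
    have h := hx
    rw [homogeneousSubmodule_zero, Submodule.mem_one] at h
    obtain ⟨c, hc⟩ := h
    exact ⟨c, Subtype.ext hc⟩
  have : IsIso (CommRingCat.ofHom (algebraMap K (homogeneousSubmodule (Fin (b + 1)) K 0))) :=
    (ConcreteCategory.isIso_iff_bijective (CommRingCat.ofHom _)).mpr hbij
  have : IsProper (Proj.toSpecZero (homogeneousSubmodule (Fin (b + 1)) K)) := inferInstance
  exact MorphismProperty.comp_mem _ _ _ this inferInstance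

/-- Every finite set of points of `Z` lies in an affine open subscheme. -/
def _root_.AlgebraicGeometry.IsAF (Z : Scheme.{0}) : Prop :=
  ∀ S : Finset Z, ∃ V : Z.Opens, IsAffineOpen V ∧ ∀ x ∈ S, x ∈ V

variable (K b) in
lemma isAF [Infinite K] : IsAF (ProjSpace K b) := by
  classical
  intro S
  let I (x : ProjSpace K b) : Ideal (MvPolynomial (Fin (b + 1)) K) :=
    (show Proj (homogeneousSubmodule (Fin (b + 1)) K) from x).asHomogeneousIdeal.toIdeal
  let W (x : ProjSpace K b) : Submodule K (Fin (b + 1) → K) :=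
    ((I x).restrictScalars K).comap
      (Fintype.linearCombination K (X : Fin (b + 1) → MvPolynomial (Fin (b + 1)) K))
  have hW : ⊤ ∉ S.image W := by
    rw [Finset.mem_image]
    rintro ⟨x, -, hx⟩
    obtain ⟨i, hi⟩ : ∃ i, X i ∉ I x := by
      have : (show Proj (homogeneousSubmodule (Fin (b + 1)) K) from x) ∈ ⨆ i : Fin (b + 1),
          Proj.basicOpen (homogeneousSubmodule (Fin (b + 1)) K) (X i) := by
        rw [iSup_basicOpen_X]; trivial
      exact TopologicalSpace.Opens.mem_iSup.mp this
    have h : Pi.single i 1 ∈ W x := hx ▸ Submodule.mem_top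
    rw [Submodule.mem_comap, Fintype.linearCombination_apply_single, one_smul] at h
    exact hi h
  obtain ⟨c, hc⟩ := (Set.ne_univ_iff_exists_notMem _).mp
    (Subspace.biUnion_ne_univ_of_top_notMem hW)
  simp only [Finset.mem_image, Set.iUnion_exists, Set.biUnion_and', Set.iUnion_iUnion_eq_right,
    Set.mem_iUnion, not_exists] at hc
  have hmem : Fintype.linearCombination K (X : Fin (b + 1) → MvPolynomial (Fin (b + 1)) K) c ∈
      homogeneousSubmodule (Fin (b + 1)) K 1 := by
    rw [Fintype.linearCombination_apply]
    exact Submodule.sum_mem _ fun i _ => Submodule.smul_mem _ _ (X_mem i)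
  exact ⟨Proj.basicOpen (homogeneousSubmodule (Fin (b + 1)) K) _,
    Proj.isAffineOpen_basicOpen _ _ hmem one_pos, hc⟩

end ProjSpace

lemma IsAF.pullback {X Y S : Scheme.{0}} [IsAffine S] {f : X ⟶ S} {g : Y ⟶ S}
    (hX : IsAF X) (hY : IsAF Y) : IsAF (pullback f g) := by
  classical
  intro T
  obtain ⟨V, hV, hTV⟩ := hX (T.image (pullback.fst f g))
  obtain ⟨W, hW, hTW⟩ := hY (T.image (pullback.snd f g))
  have : IsAffine V := hV
  have : IsAffine W := hW
  refine ⟨(pullback.map (V.ι ≫ f) (W.ι ≫ g) f g V.ι W.ι (𝟙 _) (by simp) (by simp)).opensRange,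
    isAffineOpen_opensRange _, fun x hx => ?_⟩
  rw [Scheme.Hom.mem_opensRange, ← Set.mem_range, Scheme.Pullback.range_map]
  constructor
  · simpa using hTV _ (Finset.mem_image_of_mem _ hx)
  · simpa using hTW _ (Finset.mem_image_of_mem _ hx)

section

variable {K : Type} [Field K] [Infinite K] {l : List ((Y : Scheme.{0}) × (Y ⟶ Spec (.of K)))}

/-- The properties of products of projective spaces which are used in the descent argument. -/
structure IsNiceOver {B : Scheme.{0}} (Z : Scheme.{0}) (z : Z ⟶ B) : Prop where
  isIntegral : IsIntegral Z
  isProper : IsProper z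
  isAF : IsAF Z

lemma isNiceOver_fiberProdList (hl : ∀ Y ∈ l, ∃ b, (⟨ProjSpace K b, ProjSpace.structMor K b⟩ :
      (Y : Scheme.{0}) × (Y ⟶ Spec (.of K))) = Y) :
    IsNiceOver (fiberProdList _ l).1 (fiberProdList _ l).2 := by
  induction l with
  | nil =>
    exact ⟨inferInstanceAs (IsIntegral (Spec (.of K))),
      inferInstanceAs (IsProper (𝟙 (Spec (.of K)))), fun S =>
        ⟨⊤, isAffineOpen_top (Spec (.of K)), fun _ _ => trivial⟩⟩
  | cons Y l ih =>
    obtain ⟨h1, h2, h3⟩ := ih fun Z hZ => hl Z (List.mem_cons_of_mem _ hZ)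
    obtain ⟨b, rfl⟩ := hl Y List.mem_cons_self
    have hN : IsLocallyNoetherian (fiberProdList _ l).1 :=
      LocallyOfFiniteType.isLocallyNoetherian (fiberProdList _ l).2
    refine ⟨inferInstanceAs (IsIntegral (pullback (ProjSpace.structMor K b) _)),
      inferInstanceAs (IsProper (pullback.fst (ProjSpace.structMor K b)
        (fiberProdList _ l).2 ≫ ProjSpace.structMor K b)),
      IsAF.pullback (ProjSpace.isAF K b) h3⟩

end

variable {K : Type} [Field K] {ι : Type} {a : ι → ℕ}

variable (K a) in
/-- The family of projective spaces of dimensions `a i`. -/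
noncomputable abbrev projFam (i : ι) : (Y : Scheme.{0}) × (Y ⟶ Spec (.of K)) :=
  ⟨ProjSpace K (a i), ProjSpace.structMor K (a i)⟩

/-- The morphism `m` to a product of projective spaces is given by the homogeneous coordinates
`x` over the scalars `θ`. -/
structure IsPt {P : (Y : Scheme.{0}) × (Y ⟶ Spec (.of K))} (pr : ∀ i, P.1 ⟶ ProjSpace K (a i))
    {R : Type} [CommRing R] (θ : K →+* R) (x : ∀ i, Fin (a i + 1) → R)
    (m : Spec (.of R) ⟶ P.1) : Prop where
  comp_snd : m ≫ P.2 = Spec.map (CommRingCat.ofHom θ)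
  comp_pr : ∀ i, ∃ j hj, m ≫ pr i = ProjSpace.pt θ (x i) j hj

namespace IsPt

variable {P : (Y : Scheme.{0}) × (Y ⟶ Spec (.of K))} {pr : ∀ i, P.1 ⟶ ProjSpace K (a i)}
  {R : Type} [CommRing R] {θ : K →+* R} {x y : ∀ i, Fin (a i + 1) → R}
  {m m' : Spec (.of R) ⟶ P.1}

lemma exists_of_isUnit (hP : IsProdOver (projFam K a) P pr) (θ : K →+* R)
    (hx : ∀ i, ∃ j, IsUnit (x i j)) : ∃ m, IsPt pr θ x m := by
  choose j hj using hx
  obtain ⟨m, hm, hm'⟩ := hP.exists_lift _ (Spec.map (CommRingCat.ofHom θ))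
    (fun i => ProjSpace.pt θ (x i) (j i) (hj i)) fun i => ProjSpace.pt_structMor ..
  exact ⟨m, hm, fun i => ⟨j i, hj i, hm' i⟩⟩

lemma comp_pr_eq (hx : IsPt pr θ x m) (hy : IsPt pr θ y m') (i : ι) (h : Par (x i) (y i)) :
    m ≫ pr i = m' ≫ pr i := by
  obtain ⟨j, hj, e⟩ := hx.comp_pr i
  obtain ⟨j', hj', e'⟩ := hy.comp_pr i
  rw [e, e']
  exact ProjSpace.pt_ext θ hj hj' h

lemma eq_of_par (hP : IsProdOver (projFam K a) P pr) (hx : IsPt pr θ x m) (hy : IsPt pr θ y m')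
    (h : ∀ i, Par (x i) (y i)) : m = m' :=
  hP.hom_ext _ _ _ (hx.comp_snd.trans hy.comp_snd.symm) fun i => hx.comp_pr_eq hy i (h i)

lemma specMap_comp {R' : Type} [CommRing R'] (g : R →+* R') (hx : IsPt pr θ x m) :
    IsPt pr (g.comp θ) (fun i => g ∘ x i) (Spec.map (CommRingCat.ofHom g) ≫ m) := by
  refine ⟨?_, fun i => ?_⟩
  · rw [Category.assoc, hx.comp_snd, ← Spec.map_comp, ← CommRingCat.ofHom_comp]
  · obtain ⟨j, hj, e⟩ := hx.comp_pr i
    exact ⟨j, hj.map g, by rw [Category.assoc, e, ProjSpace.SpecMap_pt]⟩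

variable {L : Type} [Field L] {η : K →+* L} {u v : ∀ i, Fin (a i + 1) → L}
  {w w' : Spec (.of L) ⟶ P.1}

lemma ne_zero (hu : IsPt pr η u w) (i : ι) : u i ≠ 0 := by
  obtain ⟨j, hj, -⟩ := hu.comp_pr i
  exact fun h => hj.ne_zero (congrFun h j)

lemma par (hu : IsPt pr η u w) (hv : IsPt pr η v w') (i : ι) (h : w ≫ pr i = w' ≫ pr i) :
    Par (u i) (v i) := by
  obtain ⟨j, hj, e⟩ := hu.comp_pr i
  obtain ⟨j', hj', e'⟩ := hv.comp_pr i
  exact ProjSpace.par_of_pt_eq hj hj' (e.symm.trans (h.trans e'))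

lemma exists_coords (hP : IsProdOver (projFam K a) P pr)
    (hw : w ≫ P.2 = Spec.map (CommRingCat.ofHom η)) :
    ∃ u, IsPt pr η u w := by
  have h (i) := ProjSpace.exists_pt_of_field (w ≫ pr i) η
    ((Category.assoc _ _ _).trans (by rw [← hw]; exact congrArg (w ≫ ·) (hP.comm i)))
  choose u j hj e using h
  exact ⟨u, hw, fun i => ⟨j i, hj i, e i⟩⟩

lemma exists_of_good (hP : IsProdOver (projFam K a) P pr) (η : K →+* L) (hu : ∀ i, u i ≠ 0) :
    ∃ w, IsPt pr η u w :=
  exists_of_isUnit hP η fun i => by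
    obtain ⟨j, hj⟩ := Function.ne_iff.mp (hu i)
    exact ⟨j, isUnit_iff_ne_zero.mpr hj⟩

end IsPt

/-- The map `Φ` describes the morphism `φ` in terms of homogeneous coordinates of points. -/
def IsCoordMap {P : (Y : Scheme.{0}) × (Y ⟶ Spec (.of K))} (pr : ∀ i, P.1 ⟶ ProjSpace K (a i))
    (θ θ' : K →+* K) (φ : P.1 ⟶ P.1) (Φ : MultiPt K a → MultiPt K a) : Prop :=
  ∀ x m, IsPt pr θ x m → IsPt pr θ' (Φ x) (m ≫ φ)

namespace IsCoordMap

variable {P : (Y : Scheme.{0}) × (Y ⟶ Spec (.of K))} {pr : ∀ i, P.1 ⟶ ProjSpace K (a i)}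
  {θ θ' : K →+* K} {φ : P.1 ⟶ P.1} {Φ : MultiPt K a → MultiPt K a}

lemma exists_isCoordMap (hP : IsProdOver (projFam K a) P pr) (θ τ : K →+* K)
    (hφ : φ ≫ P.2 = P.2 ≫ Spec.map (CommRingCat.ofHom τ)) :
    ∃ Φ, IsCoordMap pr θ (θ.comp τ) φ Φ := by
  have (x : MultiPt K a) : ∃ y : MultiPt K a,
      ∀ m, IsPt pr θ x m → IsPt pr (θ.comp τ) y (m ≫ φ) := by
    by_cases h : ∃ m, IsPt pr θ x m
    · obtain ⟨m, hm⟩ := h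
      obtain ⟨y, hy⟩ := IsPt.exists_coords (η := θ.comp τ) (w := m ≫ φ) hP (by
        rw [Category.assoc, hφ, ← Category.assoc, hm.comp_snd, ← Spec.map_comp,
          ← CommRingCat.ofHom_comp])
      refine ⟨y, fun m' hm' => ?_⟩
      rwa [hm'.eq_of_par hP hm fun i => Par.refl _]
    · exact ⟨0, fun m hm => (h ⟨m, hm⟩).elim⟩
  choose Φ hΦ using this
  exact ⟨Φ, hΦ⟩

lemma exists_local_formula [Finite ι] (hP : IsProdOver (projFam K a) P pr) {τ : K →+* K}
    (hφ : φ ≫ P.2 = P.2 ≫ Spec.map (CommRingCat.ofHom τ))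
    (hΦ : IsCoordMap pr θ (θ.comp τ) φ Φ) {x : MultiPt K a} (hx : x.Good) (j : ι) :
    ∃ (H : Fin (a j + 1) → CoxRing K a) (f : CoxRing K a), x.ev f ≠ 0 ∧
      ∀ y : MultiPt K a, y.Good → y.ev f ≠ 0 →
        (fun l => y.ev (H l)) ≠ 0 ∧ Par (fun l => y.ev (H l)) (Φ y j) := by
  have := Fintype.ofFinite ι
  choose i₀ hi₀ using fun i => Function.ne_iff.mp (hx i)
  let f₀ : CoxRing K a := ∏ i, X ⟨i, i₀ i⟩
  let R := Localization.Away f₀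
  obtain ⟨mR, hmR⟩ := IsPt.exists_of_isUnit hP (((algebraMap (CoxRing K a) R).comp C).comp θ)
    (x := fun i l => algebraMap (CoxRing K a) R (X ⟨i, l⟩)) fun i => ⟨i₀ i, by
      have h : IsUnit (algebraMap (CoxRing K a) R f₀) := IsLocalization.Away.algebraMap_isUnit _
      rw [map_prod] at h
      exact (IsUnit.prod_univ_iff.mp h) i⟩
  have he (y : MultiPt K a) (hy : y.ev f₀ ≠ 0) : ∃ e : R →+* K,
      e.comp (algebraMap (CoxRing K a) R) = y.ev :=
    ⟨IsLocalization.Away.lift f₀ (isUnit_iff_ne_zero.mpr hy), IsLocalization.Away.lift_comp ..⟩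
  have hxf₀ : x.ev f₀ ≠ 0 := by
    rw [map_prod, Finset.prod_ne_zero_iff]
    intro i _
    simpa [MultiPt.ev] using hi₀ i
  obtain ⟨ex, hex⟩ := he x hxf₀
  obtain ⟨f, j', v, hv, hf, e⟩ := ProjSpace.exists_pt (mR ≫ φ ≫ pr j)
    ((((algebraMap (CoxRing K a) R).comp C).comp θ).comp τ) (by
      have h1 : pr j ≫ ProjSpace.structMor K (a j) = P.2 := hP.comm j
      rw [Category.assoc, Category.assoc, h1, hφ, ← Category.assoc, hmR.comp_snd,
        ← Spec.map_comp, ← CommRingCat.ofHom_comp]) (PrimeSpectrum.comap ex ⊥)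
  have hexf : ex f ≠ 0 := fun h => hf (by simpa using h)
  obtain ⟨M, g, hg⟩ := IsLocalization.Away.surj f₀ f
  obtain ⟨b₁, hb₁⟩ := IsLocalization.exist_integer_multiples_of_finite (Submonoid.powers f) v
  choose r hr using hb₁
  obtain ⟨b₂, hb₂⟩ := IsLocalization.exist_integer_multiples_of_finite (Submonoid.powers f₀) r
  choose H hH using hb₂
  refine ⟨H, f₀ * g, ?_, fun y hy hyf => ?_⟩
  · rw [map_mul]
    refine mul_ne_zero hxf₀ ?_
    rw [← hex, RingHom.comp_apply, ← hg, map_mul, map_pow, ← RingHom.comp_apply, hex]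
    exact mul_ne_zero hexf (pow_ne_zero _ hxf₀)
  · rw [map_mul] at hyf
    obtain ⟨ey, hey⟩ := he y (left_ne_zero_of_mul hyf)
    have hyg := right_ne_zero_of_mul hyf
    rw [← hey, RingHom.comp_apply, ← hg, map_mul] at hyg
    let ey' : Localization.Away f →+* K := IsLocalization.Away.lift f
      (isUnit_iff_ne_zero.mpr (left_ne_zero_of_mul hyg))
    have hey' : ey'.comp (algebraMap R _) = ey := IsLocalization.Away.lift_comp ..
    have hcoord : (fun l => y.ev (H l)) = (ey b₁ * y.ev b₂) • (ey' ∘ v) := by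
      ext l
      have h1 := congrArg ey' (hr l)
      have h2 := congrArg ey (hH l)
      rw [← RingHom.comp_apply, hey', Algebra.smul_def, map_mul, ← RingHom.comp_apply, hey'] at h1
      rw [← RingHom.comp_apply, hey, Algebra.smul_def, map_mul, ← RingHom.comp_apply, hey, h1] at h2
      simp only [Pi.smul_apply, smul_eq_mul, Function.comp_apply, h2]
      ring
    have hc : ey b₁ * y.ev b₂ ≠ 0 := by
      obtain ⟨_, n₁, rfl⟩ := b₁
      obtain ⟨_, n₂, rfl⟩ := b₂
      simp only [map_pow]
      exact mul_ne_zero (pow_ne_zero _ (left_ne_zero_of_mul hyg))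
        (pow_ne_zero _ (left_ne_zero_of_mul hyf))
    have hθ : ey.comp (((algebraMap (CoxRing K a) R).comp C).comp θ) = θ := by
      rw [RingHom.comp_assoc, ← RingHom.comp_assoc, hey]
      ext c
      simp [MultiPt.ev]
    have hpt : IsPt pr θ y (Spec.map (CommRingCat.ofHom ey) ≫ mR) := by
      have h := hmR.specMap_comp ey
      rw [hθ] at h
      convert h using 3 with i
      ext l
      rw [Function.comp_apply, ← RingHom.comp_apply, hey]
      simp [MultiPt.ev]
    obtain ⟨j'', hj'', e''⟩ := (hΦ y _ hpt).comp_pr j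
    have e₁ : Spec.map (CommRingCat.ofHom ey') ≫
        Spec.map (CommRingCat.ofHom (algebraMap R (Localization.Away f))) =
          Spec.map (CommRingCat.ofHom ey) := by
      rw [← Spec.map_comp, ← CommRingCat.ofHom_comp, hey']
    have e₂ := congrArg (Spec.map (CommRingCat.ofHom ey') ≫ ·) e
    simp only [← Category.assoc] at e₂
    rw [e₁, ProjSpace.SpecMap_pt] at e₂
    have hθ' : ey'.comp ((algebraMap R (Localization.Away f)).comp
        ((((algebraMap (CoxRing K a) R).comp C).comp θ).comp τ)) = θ.comp τ := by
      rw [← RingHom.comp_assoc, hey', ← RingHom.comp_assoc, hθ]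
    simp only [hθ'] at e₂
    rw [hcoord]
    have hj' : IsUnit ((ey' ∘ v) j') := by simp [hv]
    refine ⟨smul_ne_zero hc fun h => hj'.ne_zero (congrFun h j'), ?_⟩
    have hpar : Par (ey' ∘ v) (Φ y j) := ProjSpace.par_of_pt_eq hj' hj'' (e₂.symm.trans e'')
    exact (Par.smul_left _ _).trans hpar fun h => hj'.ne_zero (congrFun h j')

lemma isRegularOnCoords [Finite ι] (hP : IsProdOver (projFam K a) P pr) {τ : K →+* K}
    (hφ : φ ≫ P.2 = P.2 ≫ Spec.map (CommRingCat.ofHom τ))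
    (hΦ : IsCoordMap pr θ (θ.comp τ) φ Φ) : IsRegularOnCoords Φ where
  good x hx j := by
    obtain ⟨m, hm⟩ := IsPt.exists_of_good hP θ hx
    exact (hΦ x m hm).ne_zero j
  par x y hx hy h j := by
    obtain ⟨m, hm⟩ := IsPt.exists_of_good hP θ hx
    obtain ⟨m', hm'⟩ := IsPt.exists_of_good hP θ hy
    refine (hΦ x m hm).par (hΦ y m' hm') j ?_
    rw [hm.eq_of_par hP hm' h]
  loc x hx j := exists_local_formula hP hφ hΦ hx j

lemma par_comp (hP : IsProdOver (projFam K a) P pr) {φ' : P.1 ⟶ P.1}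
    {Ψ : MultiPt K a → MultiPt K a} (hΦ : IsCoordMap pr θ θ' φ Φ) (hΨ : IsCoordMap pr θ' θ φ' Ψ)
    (h : φ ≫ φ' = 𝟙 _) (x : MultiPt K a) (hx : x.Good) (i : ι) : Par (Ψ (Φ x) i) (x i) := by
  obtain ⟨m, hm⟩ := IsPt.exists_of_good hP θ hx
  refine (hΨ _ _ (hΦ x m hm)).par hm i ?_
  have e : (m ≫ φ) ≫ φ' = m := by rw [Category.assoc, h, Category.comp_id]
  rw [e]

end IsCoordMap

/-- A semilinear automorphism of a product of projective spaces is compatible with the projections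
to the products of all factors of a given dimension. -/
lemma comp_pr_eq_of_dim_eq [CharZero K] [IsAlgClosed K] [Finite ι] (ha : ∀ i, 1 ≤ a i)
    {P : (Y : Scheme.{0}) × (Y ⟶ Spec (.of K))} {pr : ∀ i, P.1 ⟶ ProjSpace K (a i)}
    (hP : IsProdOver (projFam K a) P pr) {φ φ' : P.1 ⟶ P.1} (τ : K ≃+* K)
    (hφ : φ ≫ P.2 = P.2 ≫ Spec.map (CommRingCat.ofHom τ))
    (hφ' : φ' ≫ P.2 = P.2 ≫ Spec.map (CommRingCat.ofHom τ.symm))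
    (h : φ ≫ φ' = 𝟙 _) (h' : φ' ≫ φ = 𝟙 _) (d : ℕ) {u v : Spec (.of K) ⟶ P.1}
    (hu : u ≫ P.2 = 𝟙 _) (hv : v ≫ P.2 = 𝟙 _)
    (huv : ∀ i, a i = d → u ≫ pr i = v ≫ pr i) (j : ι) (hj : a j = d) :
    u ≫ φ ≫ pr j = v ≫ φ ≫ pr j := by
  have := Fintype.ofFinite ι
  obtain ⟨Φ, hΦ⟩ := IsCoordMap.exists_isCoordMap hP (RingHom.id K) τ hφ
  obtain ⟨Ψ, hΨ⟩ := IsCoordMap.exists_isCoordMap hP (((RingHom.id K).comp (τ : K →+* K)))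
    (τ.symm : K →+* K) hφ'
  have hΦr := hΦ.isRegularOnCoords hP hφ
  have hΨr := hΨ.isRegularOnCoords hP hφ'
  have hid : ((RingHom.id K).comp (τ : K →+* K)).comp (τ.symm : K →+* K) = RingHom.id K := by
    ext c; simp
  rw [hid] at hΨ
  have hspec : Spec.map (CommRingCat.ofHom (RingHom.id K)) = 𝟙 _ := Spec.map_id _
  obtain ⟨x, hx⟩ := IsPt.exists_coords hP (hu.trans hspec.symm)
  obtain ⟨y, hy⟩ := IsPt.exists_coords hP (hv.trans hspec.symm)
  have hpar := hΦr.par_of_dim_eq ha hΨr (hΦ.par_comp hP hΨ h) (hΨ.par_comp hP hΦ h') d x y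
    hx.ne_zero hy.ne_zero (fun i hi => hx.par hy i (huv i hi)) j hj
  have := (hΦ x u hx).comp_pr_eq (hΦ y v hy) j hpar
  rwa [Category.assoc, Category.assoc] at this

/-- A morphism of products is a base change of another one if it is so blockwise. -/
lemma IsProdOver.isPullback_of_forall {B B' : Scheme.{0}} {φ : B' ⟶ B} {ι κ : Type} {c : ι → κ}
    {F : ι → (Y : Scheme.{0}) × (Y ⟶ B')} {P : (Y : Scheme.{0}) × (Y ⟶ B')}
    {pr : ∀ i, P.1 ⟶ (F i).1} (hP : IsProdOver F P pr)
    {G : κ → (Y : Scheme.{0}) × (Y ⟶ B)} {W : (Y : Scheme.{0}) × (Y ⟶ B)}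
    {w : ∀ s, W.1 ⟶ (G s).1} (hW : IsProdOver G W w)
    {Z : κ → (Y : Scheme.{0}) × (Y ⟶ B')}
    {z : ∀ s, ∀ i : {i | c i = s}, (Z s).1 ⟶ (F i).1}
    (hZ : ∀ s, IsProdOver (fun i : {i | c i = s} => F i) (Z s) (z s))
    {β : ∀ s, (Z s).1 ⟶ (G s).1} (hβ : ∀ s, IsPullback (β s) (Z s).2 (G s).2 φ)
    {π : ∀ s, P.1 ⟶ (Z s).1} (hπ : ∀ s, π s ≫ (Z s).2 = P.2)
    (hπ' : ∀ s i, π s ≫ z s i = pr i) {l : P.1 ⟶ W.1} (hl : l ≫ W.2 = P.2 ≫ φ)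
    (hl' : ∀ s, l ≫ w s = π s ≫ β s) : IsPullback l P.2 W.2 φ := by
  have key : ∀ (T : Scheme.{0}) (t1 : T ⟶ W.1) (t2 : T ⟶ B'), t1 ≫ W.2 = t2 ≫ φ →
      ∃ L : T ⟶ P.1, L ≫ l = t1 ∧ L ≫ P.2 = t2 := by
    intro T t1 t2 ht
    have hu : ∀ s, ∃ u : T ⟶ (Z s).1, u ≫ β s = t1 ≫ w s ∧ u ≫ (Z s).2 = t2 := fun s =>
      have e : (t1 ≫ w s) ≫ (G s).2 = t2 ≫ φ := by rw [Category.assoc, hW.comm, ht]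
      ⟨(hβ s).lift _ _ e, (hβ s).lift_fst _ _ e, (hβ s).lift_snd _ _ e⟩
    choose u hu1 hu2 using hu
    obtain ⟨L, hL, hL'⟩ := hP.exists_lift T t2 (fun i => u (c i) ≫ z (c i) ⟨i, rfl⟩) fun i => by
      rw [Category.assoc]
      exact congr(u (c i) ≫ $((hZ (c i)).comm ⟨i, rfl⟩)).trans (hu2 _)
    have hLπ : ∀ s, L ≫ π s = u s := fun s => by
      refine (hZ s).hom_ext T _ _ ?_ ?_
      · rw [Category.assoc, hπ, hL, hu2]
      · rintro ⟨i, rfl⟩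
        rw [Category.assoc, hπ', hL']
    refine ⟨L, hW.hom_ext T _ _ ?_ fun s => ?_, hL⟩
    · rw [Category.assoc, hl, ht, ← Category.assoc, hL]
    · rw [Category.assoc, hl', ← Category.assoc, hLπ, hu1]
  choose L hL hL' using key
  refine ⟨⟨hl⟩, ⟨PullbackCone.IsLimit.mk _ (fun x => L x.pt x.fst x.snd x.condition)
    (fun x => hL _ _ _ _) (fun x => hL' _ _ _ _) fun x y h1 h2 => ?_⟩⟩
  refine hP.hom_ext _ _ _ (h2.trans (hL' _ _ _ _).symm) fun i => ?_
  have e : y ≫ π (c i) = L x.pt x.fst x.snd x.condition ≫ π (c i) := by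
    refine (hβ (c i)).hom_ext ?_ ?_
    · rw [Category.assoc, Category.assoc, ← hl', ← Category.assoc, ← Category.assoc, h1, hL]
    · rw [Category.assoc, Category.assoc, hπ, h2, hL']
  rw [← hπ' (c i) ⟨i, rfl⟩, ← Category.assoc, e, Category.assoc]

section Blocks

variable {k K : Type} [Field k] [Field K] [Algebra k K]

lemma exists_isProdOver_block {n : ℕ} (a : Fin n → ℕ) {S : Set (Fin n)} {D M : ℕ}
    (hS : ∀ i, i ∈ S ↔ a i = D) (hM : M = (Finset.univ.filter fun i => a i = D).card) :
    ∃ z, IsProdOver (fun i : S => projFam K a i)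
      (fiberProdList (Spec (.of K)) (List.ofFn fun _ : Fin M =>
        ⟨ProjSpace K D, ProjSpace.structMor K D⟩)) z := by
  classical
  have hc : Nat.card S = M := by
    rw [hM, Nat.card_eq_fintype_card, Fintype.card_of_subtype]
    simpa using fun i => (hS i).symm
  let e : Fin M ≃ S := (finCongr hc.symm).trans (Finite.equivFin S).symm
  obtain ⟨p, hp⟩ := IsProdOver.exists_fiberProdList (B := Spec (.of K)) M
    fun _ => ⟨ProjSpace K D, ProjSpace.structMor K D⟩
  have hF : (fun _ : Fin M => (⟨ProjSpace K D, ProjSpace.structMor K D⟩ :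
      (Y : Scheme.{0}) × (Y ⟶ Spec (.of K)))) = fun j => projFam K a (e j) := by
    funext j
    have := (hS _).1 (e j).2
    dsimp only [projFam]
    rw [this]
  have h : ∀ F' : Fin M → (Y : Scheme.{0}) × (Y ⟶ Spec (.of K)),
      (fun _ : Fin M => ⟨ProjSpace K D, ProjSpace.structMor K D⟩) = F' →
      ∃ p', IsProdOver F' (fiberProdList (Spec (.of K)) (List.ofFn fun _ : Fin M =>
        ⟨ProjSpace K D, ProjSpace.structMor K D⟩)) p' := by
    rintro _ rfl
    exact ⟨p, hp⟩
  obtain ⟨p', hp'⟩ := h _ hF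
  exact hp'.exists_reindex e

/-- The contraction of a form of a product of projective spaces onto all the factors of a given
dimension is defined over the base field. -/
lemma exists_block_descent [CharZero K] [IsAlgClosed K] [Normal k K] {n : ℕ} {a : Fin n → ℕ}
    (ha : ∀ i, 1 ≤ a i) {X P : Scheme.{0}} {f : X ⟶ Spec (CommRingCat.of k)} {q : P ⟶ X}
    {p : P ⟶ Spec (CommRingCat.of K)} (H : IsPullback q p f (specAlg k K))
    [LocallyOfFiniteType f] [QuasiCompact f] [IsReduced P] {pr : ∀ i, P ⟶ ProjSpace K (a i)}
    (hP : IsProdOver (projFam K a) ⟨P, p⟩ pr) {S : Set (Fin n)} (hne : S.Nonempty) {D M : ℕ}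
    (hS : ∀ i, i ∈ S ↔ a i = D) (hM : M = (Finset.univ.filter fun i => a i = D).card)
    {Z : (Y : Scheme.{0}) × (Y ⟶ Spec (.of K))}
    (hZM : Z = fiberProdList (Spec (.of K)) (List.ofFn fun _ : Fin M =>
        ⟨ProjSpace K D, ProjSpace.structMor K D⟩)) :
    ∃ (Y : (Y : Scheme.{0}) × (Y ⟶ Spec (.of k))) (β : Z.1 ⟶ Y.1) (r : X ⟶ Y.1) (π : P ⟶ Z.1)
      (z : ∀ i : S, Z.1 ⟶ (projFam K a i).1),
      IsPullback β Z.2 Y.2 (specAlg k K) ∧ r ≫ Y.2 = f ∧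
      IsProdOver (fun i : S => projFam K a i) Z z ∧ π ≫ Z.2 = p ∧ (∀ i, π ≫ z i = pr i) ∧
      q ≫ r = π ≫ β := by
  obtain ⟨z, hz⟩ : ∃ z, IsProdOver (fun i : S => projFam K a i) Z z :=
    hZM ▸ exists_isProdOver_block a hS hM
  have hnice : IsNiceOver Z.1 Z.2 := by
    subst hZM
    refine isNiceOver_fiberProdList fun Y hY => ?_
    obtain ⟨i, rfl⟩ := (List.mem_ofFn' _ _).mp hY
    exact ⟨_, rfl⟩
  obtain ⟨lq, y, hy, hlq⟩ := exists_isProdOver fun i : (Sᶜ : Set (Fin n)) => projFam K a i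
  have hnice' : IsNiceOver (fiberProdList _ lq).1 (fiberProdList _ lq).2 :=
    isNiceOver_fiberProdList fun Y hY => by
      obtain ⟨i, hi⟩ := hlq Y hY
      exact ⟨_, hi⟩
  obtain ⟨π, ρ, hπ, hπz⟩ := hP.isPullback_of_compl S hz hy
  have hπp : π ≫ Z.2 = p := by
    obtain ⟨i, hi⟩ := hne
    rw [← hz.comm ⟨i, hi⟩, ← Category.assoc, hπz]
    exact hP.comm i
  have := hnice.isProper
  have := hnice'.isProper
  have := hnice'.isIntegral
  obtain ⟨Y, g, β, r, h1, h2, h3⟩ := exists_descent H hπ hπp hnice.isAF fun σ u v hu hv huv => by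
    refine hz.hom_ext _ _ _ ?_ fun i => ?_
    · simp only [Category.assoc, hπp, galAct_snd]
      rw [reassoc_of% hu, reassoc_of% hv]
    · simp only [Category.assoc, hπz]
      refine comp_pr_eq_of_dim_eq ha hP (φ := galAct H σ) (φ' := galAct H σ⁻¹) σ.toRingEquiv
        (galAct_snd H σ) (galAct_snd H σ⁻¹) ?_ ?_ D hu hv (fun j hj => ?_) i ((hS _).1 i.2)
      · rw [← galAct_mul, mul_inv_cancel, galAct_one]
      · rw [← galAct_mul, inv_mul_cancel, galAct_one]
      · rw [← hπz ⟨j, (hS j).2 hj⟩, reassoc_of% huv]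
  exact ⟨⟨Y, g⟩, β, r, π, z, h1, h2, hz, hπp, hπz, h3⟩

lemma isIso_of_isPullback_specAlg {X W P : Scheme.{0}} {f : X ⟶ Spec (CommRingCat.of k)}
    {w : W ⟶ Spec (CommRingCat.of k)} {q : P ⟶ X} {p : P ⟶ Spec (CommRingCat.of K)}
    [Normal k K] (H : IsPullback q p f (specAlg k K)) {l : X ⟶ W} (hl : l ≫ w = f)
    (H' : IsPullback (q ≫ l) p w (specAlg k K)) : IsIso l := by
  have h : IsPullback (𝟙 P) q (q ≫ l) l :=
    IsPullback.of_right (by rw [Category.id_comp, hl]; exact H.flip) (Category.id_comp _) H'.flip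
  have h1 : Surjective (q ≫ l) := MorphismProperty.of_isPullback H'.flip (surjective_specAlg)
  have h2 : Flat (q ≫ l) :=
    MorphismProperty.of_isPullback H'.flip (inferInstance : Flat (specAlg k K))
  have h3 : QuasiCompact (q ≫ l) :=
    MorphismProperty.of_isPullback H'.flip (inferInstance : QuasiCompact (specAlg k K))
  refine MorphismProperty.of_isPullback_of_descendsAlong
    (P := MorphismProperty.isomorphisms Scheme) (Q := @Surjective ⊓ @Flat ⊓ @QuasiCompact)
    (f := q ≫ l) (fst := 𝟙 P) (snd := q) h ⟨⟨h1, h2⟩, h3⟩ (inferInstanceAs (IsIso (𝟙 P)))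

end Blocks

/-- A `k`-form `X` of a product of projective spaces
`ℙ^{a₁} × ⋯ × ℙ^{aₙ}` decomposes as a fiber product over `k` of `k`-forms
`Y₁, …, Y_r` of the products of the equal-dimensional factors: if
`d₁ < ⋯ < d_r` are the distinct values among the `aᵢ` and `m_s` is the number
of indices `i` with `aᵢ = d_s`, then `X ≅ Y₁ ×ₖ ⋯ ×ₖ Y_r` over `k` with the
base change of `Y_s` to the algebraic closure isomorphic over it to
`(ℙ^{d_s})^{m_s}`. -/
theorem form_of_prod_projSpace_decomposes
    (k K : Type) [Field k] [CharZero k] [Field K] [Algebra k K]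
    [IsAlgClosure k K]
    (n : ℕ) (a : Fin n → ℕ) (ha : ∀ i, 1 ≤ a i)
    (X : Scheme) [IsIntegral X] (f : X ⟶ Spec (CommRingCat.of k))
    [LocallyOfFiniteType f] [QuasiCompact f]
    -- the base change `X ×ₖ K` is, as a scheme over `K`, a product of
    -- projective spaces `ℙ^{a₁}_K ×_K ⋯ ×_K ℙ^{aₙ}_K`
    (hform : ∃ e : pullback f (Spec.map (CommRingCat.ofHom (algebraMap k K))) ≅
        (fiberProdList (Spec (CommRingCat.of K))
          (List.ofFn fun i => ⟨ProjSpace K (a i), ProjSpace.structMor K (a i)⟩)).1,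
      e.hom ≫ (fiberProdList (Spec (CommRingCat.of K))
          (List.ofFn fun i => ⟨ProjSpace K (a i), ProjSpace.structMor K (a i)⟩)).2 =
        pullback.snd f (Spec.map (CommRingCat.ofHom (algebraMap k K))))
    -- `d₁ < d₂ < ⋯ < d_r` are exactly the distinct values among `a₁, …, aₙ`
    (r : ℕ) (d : Fin r → ℕ) (hd : StrictMono d)
    (hval : ∀ i, ∃ s, a i = d s) (hattain : ∀ s, ∃ i, a i = d s)
    -- `m_s` is the number of indices `i` with `aᵢ = d_s`
    (m : Fin r → ℕ)
    (hm : ∀ s, m s = (Finset.univ.filter fun i => a i = d s).card) :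
    ∃ (Y : Fin r → Scheme) (g : ∀ s, Y s ⟶ Spec (CommRingCat.of k)),
      -- `X ≅ Y₁ ×ₖ ⋯ ×ₖ Y_r` over `k`
      (∃ e : X ≅
          (fiberProdList (Spec (CommRingCat.of k))
            (List.ofFn fun s => ⟨Y s, g s⟩)).1,
        e.hom ≫ (fiberProdList (Spec (CommRingCat.of k))
            (List.ofFn fun s => ⟨Y s, g s⟩)).2 = f) ∧
      -- and each `Y_s` is a `k`-form of `(ℙ^{d_s})^{m_s}`
      ∀ s, ∃ eY : pullback (g s) (Spec.map (CommRingCat.ofHom (algebraMap k K))) ≅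
          (fiberProdList (Spec (CommRingCat.of K))
            (List.ofFn fun _ : Fin (m s) =>
              ⟨ProjSpace K (d s), ProjSpace.structMor K (d s)⟩)).1,
        eY.hom ≫ (fiberProdList (Spec (CommRingCat.of K))
            (List.ofFn fun _ : Fin (m s) =>
              ⟨ProjSpace K (d s), ProjSpace.structMor K (d s)⟩)).2 =
          pullback.snd (g s) (Spec.map (CommRingCat.ofHom (algebraMap k K))) := by
  have : IsAlgClosed K := IsAlgClosure.isAlgClosed k
  have : Normal k K := IsAlgClosure.normal k K
  have : CharZero K := charZero_of_injective_algebraMap (algebraMap k K).injective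
  let P := pullback f (specAlg k K)
  let q : P ⟶ X := pullback.fst _ _
  let p : P ⟶ Spec (CommRingCat.of K) := pullback.snd _ _
  have H : IsPullback q p f (specAlg k K) := IsPullback.of_hasPullback _ _
  obtain ⟨e, he⟩ := hform
  obtain ⟨pr, hP⟩ : ∃ pr, IsProdOver (projFam K a) ⟨P, p⟩ pr := by
    obtain ⟨pr, hpr⟩ := IsProdOver.exists_fiberProdList n (projFam K a)
    exact ⟨_, hpr.of_iso e p he⟩
  have : IsReduced P := by
    have : IsIntegral (fiberProdList (Spec (CommRingCat.of K))
        (List.ofFn fun i => ⟨ProjSpace K (a i), ProjSpace.structMor K (a i)⟩)).1 :=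
      (isNiceOver_fiberProdList fun Y hY => by
        obtain ⟨i, rfl⟩ := (List.mem_ofFn' _ _).mp hY
        exact ⟨_, rfl⟩).isIntegral
    exact isReduced_of_isOpenImmersion e.hom
  choose c hc using hval
  have hS (s) (i) : i ∈ {i | c i = s} ↔ a i = d s := by
    rw [hc i, hd.injective.eq_iff, Set.mem_ofPred_eq]
  choose Y β t π z hβ hr hz hπ hπ' hq using fun s =>
    exists_block_descent (k := k) ha H hP (S := {i | c i = s})
      ((hattain s).imp fun i => (hS s i).2) (hS s) (hm s) rfl
  obtain ⟨w, hw⟩ := IsProdOver.exists_fiberProdList r Y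
  obtain ⟨l, hl, hl'⟩ := hw.exists_lift X f t hr
  have hW : IsPullback (q ≫ l) p (fiberProdList _ (List.ofFn Y)).2 (specAlg k K) :=
    hP.isPullback_of_forall hw hz hβ hπ hπ' (by rw [Category.assoc, hl, H.w]) fun s => by
      rw [Category.assoc, hl', hq]
  have : IsIso l := isIso_of_isPullback_specAlg H hl hW
  exact ⟨fun s => (Y s).1, fun s => (Y s).2, ⟨asIso l, hl⟩,
    fun s => ⟨(hβ s).isoPullback.symm, (hβ s).isoPullback_inv_snd⟩⟩
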